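/- arXiv:2403.09927 — 4 statements merged into one kernel-verified Lean document; each statement's English description precedes it below -/
import Mathlib

section
/- Let 1 ≤ n ≤ 5. For every n×n positive semidefinite matrix X with integer entries there exist a finite index set K and vectors x_i ∈ ℤⁿ, i ∈ K, such that X = Σ_{i∈K} x_i x_iᵀ (an integer rank-1 decomposition). -/
open Matrix

set_option linter.unusedSimpArgs false

namespace IntRankOne

def t2 (a b c d : ℤ) : ℤ := a * d - b * c
def t3 (a b c d e f g h i : ℤ) : ℤ := a * t2 e f h i - b * t2 d f g i + c * t2 d e g h
def t4 (a b c d e f g h i j k l m n o p : ℤ) : ℤ :=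
  a * t3 f g h j k l n o p - b * t3 e g h i k l m o p + c * t3 e f h i j l m n p
    - d * t3 e f g i j k m n o

/-- Leading principal minors, written with the upper triangular entries only. -/
def E (g : ℕ → ℕ → ℤ) : ℕ → ℤ
  | 0 => 1
  | 1 => g 0 0
  | 2 => t2 (g 0 0) (g 0 1) (g 0 1) (g 1 1)
  | 3 => t3 (g 0 0) (g 0 1) (g 0 2) (g 0 1) (g 1 1) (g 1 2) (g 0 2) (g 1 2) (g 2 2)
  | 4 => t4 (g 0 0) (g 0 1) (g 0 2) (g 0 3) (g 0 1) (g 1 1) (g 1 2) (g 1 3)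
            (g 0 2) (g 1 2) (g 2 2) (g 2 3) (g 0 3) (g 1 3) (g 2 3) (g 3 3)
  | 5 => g 0 4 * t4 (g 0 1) (g 0 2) (g 0 3) (g 0 4) (g 1 1) (g 1 2) (g 1 3) (g 1 4)
            (g 1 2) (g 2 2) (g 2 3) (g 2 4) (g 1 3) (g 2 3) (g 3 3) (g 3 4)
        - g 1 4 * t4 (g 0 0) (g 0 2) (g 0 3) (g 0 4) (g 0 1) (g 1 2) (g 1 3) (g 1 4)
            (g 0 2) (g 2 2) (g 2 3) (g 2 4) (g 0 3) (g 2 3) (g 3 3) (g 3 4)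
        + g 2 4 * t4 (g 0 0) (g 0 1) (g 0 3) (g 0 4) (g 0 1) (g 1 1) (g 1 3) (g 1 4)
            (g 0 2) (g 1 2) (g 2 3) (g 2 4) (g 0 3) (g 1 3) (g 3 3) (g 3 4)
        - g 3 4 * t4 (g 0 0) (g 0 1) (g 0 2) (g 0 4) (g 0 1) (g 1 1) (g 1 2) (g 1 4)
            (g 0 2) (g 1 2) (g 2 2) (g 2 4) (g 0 3) (g 1 3) (g 2 3) (g 3 4)
        + g 4 4 * t4 (g 0 0) (g 0 1) (g 0 2) (g 0 3) (g 0 1) (g 1 1) (g 1 2) (g 1 3)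
            (g 0 2) (g 1 2) (g 2 2) (g 2 3) (g 0 3) (g 1 3) (g 2 3) (g 3 3)
  | _ => 1

/-- The minors with rows `0, …, k-1` and columns `0, …, k-2, k`. -/
def mm (g : ℕ → ℕ → ℤ) : ℕ → ℤ
  | 1 => g 0 1
  | 2 => t2 (g 0 0) (g 0 2) (g 0 1) (g 1 2)
  | 3 => t3 (g 0 0) (g 0 1) (g 0 3) (g 0 1) (g 1 1) (g 1 3) (g 0 2) (g 1 2) (g 2 3)
  | 4 => t4 (g 0 0) (g 0 1) (g 0 2) (g 0 4) (g 0 1) (g 1 1) (g 1 2) (g 1 4)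
            (g 0 2) (g 1 2) (g 2 2) (g 2 4) (g 0 3) (g 1 3) (g 2 3) (g 3 4)
  | _ => 0

/-- Cofactors of the last column of the leading `k × k` block. -/
def cof (g : ℕ → ℕ → ℤ) : ℕ → ℕ → ℤ
  | 1, 0 => 1
  | 2, 0 => - g 0 1
  | 2, 1 => g 0 0
  | 3, 0 => t2 (g 0 1) (g 0 2) (g 1 1) (g 1 2)
  | 3, 1 => - t2 (g 0 0) (g 0 2) (g 0 1) (g 1 2)
  | 3, 2 => t2 (g 0 0) (g 0 1) (g 0 1) (g 1 1)
  | 4, 0 => - t3 (g 0 1) (g 0 2) (g 0 3) (g 1 1) (g 1 2) (g 1 3) (g 1 2) (g 2 2) (g 2 3)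
  | 4, 1 => t3 (g 0 0) (g 0 2) (g 0 3) (g 0 1) (g 1 2) (g 1 3) (g 0 2) (g 2 2) (g 2 3)
  | 4, 2 => - t3 (g 0 0) (g 0 1) (g 0 3) (g 0 1) (g 1 1) (g 1 3) (g 0 2) (g 1 2) (g 2 3)
  | 4, 3 => t3 (g 0 0) (g 0 1) (g 0 2) (g 0 1) (g 1 1) (g 1 2) (g 0 2) (g 1 2) (g 2 2)
  | 5, 0 => t4 (g 0 1) (g 0 2) (g 0 3) (g 0 4) (g 1 1) (g 1 2) (g 1 3) (g 1 4)
            (g 1 2) (g 2 2) (g 2 3) (g 2 4) (g 1 3) (g 2 3) (g 3 3) (g 3 4)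
  | 5, 1 => - t4 (g 0 0) (g 0 2) (g 0 3) (g 0 4) (g 0 1) (g 1 2) (g 1 3) (g 1 4)
            (g 0 2) (g 2 2) (g 2 3) (g 2 4) (g 0 3) (g 2 3) (g 3 3) (g 3 4)
  | 5, 2 => t4 (g 0 0) (g 0 1) (g 0 3) (g 0 4) (g 0 1) (g 1 1) (g 1 3) (g 1 4)
            (g 0 2) (g 1 2) (g 2 3) (g 2 4) (g 0 3) (g 1 3) (g 3 3) (g 3 4)
  | 5, 3 => - t4 (g 0 0) (g 0 1) (g 0 2) (g 0 4) (g 0 1) (g 1 1) (g 1 2) (g 1 4)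
            (g 0 2) (g 1 2) (g 2 2) (g 2 4) (g 0 3) (g 1 3) (g 2 3) (g 3 4)
  | 5, 4 => t4 (g 0 0) (g 0 1) (g 0 2) (g 0 3) (g 0 1) (g 1 1) (g 1 2) (g 1 3)
            (g 0 2) (g 1 2) (g 2 2) (g 2 3) (g 0 3) (g 1 3) (g 2 3) (g 3 3)
  | _, _ => 0

theorem cof_last (g : ℕ → ℕ → ℤ) (k : ℕ) (hk : k < 5) : cof g (k + 1) k = E g k := by
  interval_cases k <;> rfl

theorem cof_big (g : ℕ → ℕ → ℤ) (k i : ℕ) (hk : k < 5) (h : k < i) : cof g (k + 1) i = 0 := by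
  interval_cases k <;>
  · rcases i with _ | _ | _ | _ | _ | i <;> first | omega | rfl

theorem cof_mul (g : ℕ → ℕ → ℤ) (hg : ∀ i j, g i j = g j i) (k i : ℕ) (hk : k < 5) (hi : i ≤ k) :
    cof g (k + 1) 0 * g 0 i + cof g (k + 1) 1 * g 1 i + cof g (k + 1) 2 * g 2 i
      + cof g (k + 1) 3 * g 3 i + cof g (k + 1) 4 * g 4 i = if i = k then E g (k + 1) else 0 := by
  have h10 := hg 1 0
  have h20 := hg 2 0
  have h30 := hg 3 0
  have h40 := hg 4 0
  have h21 := hg 2 1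
  have h31 := hg 3 1
  have h41 := hg 4 1
  have h32 := hg 3 2
  have h42 := hg 4 2
  have h43 := hg 4 3
  interval_cases k <;> interval_cases i <;>
    simp only [cof, E, t2, t3, t4, Nat.reduceAdd, h10, h20, h30, h40, h21, h31, h41, h32, h42, h43,
      reduceIte, OfNat.ofNat_ne_zero, Nat.reduceEqDiff, zero_ne_one, one_ne_zero, OfNat.zero_ne_ofNat,
      OfNat.one_ne_ofNat] <;> ring

/-- The Gram matrix after the elementary step at `j`. -/
def gstep (g : ℕ → ℕ → ℤ) (j : ℕ) (t : ℤ) (a b : ℕ) : ℤ :=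
  if a = j then
    (if b = j then g (j+1) (j+1) + 2 * t * g j (j+1) + t ^ 2 * g j j
     else if b = j + 1 then g j (j+1) + t * g j j
     else g (j+1) b + t * g j b)
  else if a = j + 1 then
    (if b = j then g j (j+1) + t * g j j
     else if b = j + 1 then g j j
     else g j b)
  else
    (if b = j then g a (j+1) + t * g a j
     else if b = j + 1 then g a j
     else g a b)

set_option maxHeartbeats 1000000 in
theorem E_step_ne (g : ℕ → ℕ → ℤ) (hg : ∀ i j, g i j = g j i) (j : ℕ) (hj : j < 4) (t : ℤ)
    (k : ℕ) (hk : k ≤ 5) (hkj : k ≠ j + 1) : E (gstep g j t) k = E g k := by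
  have h10 := hg 1 0
  have h20 := hg 2 0
  have h30 := hg 3 0
  have h40 := hg 4 0
  have h21 := hg 2 1
  have h31 := hg 3 1
  have h41 := hg 4 1
  have h32 := hg 3 2
  have h42 := hg 4 2
  have h43 := hg 4 3
  interval_cases j <;> interval_cases k <;> first
    | exact absurd rfl hkj
    | (simp [E, gstep, t2, t3, t4, h10, h20, h30, h40, h21, h31, h41, h32, h42, h43]; done)
    | (simp [E, gstep, t2, t3, t4, h10, h20, h30, h40, h21, h31, h41, h32, h42, h43]; ring)

set_option maxHeartbeats 2000000 in
theorem E_step_eq (g : ℕ → ℕ → ℤ) (hg : ∀ i j, g i j = g j i) (j : ℕ) (hj : j < 4) (t : ℤ) :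
    E (gstep g j t) (j + 1) * E g (j + 1)
      = E g (j + 2) * E g j + (mm g (j + 1) + t * E g (j + 1)) ^ 2 := by
  have h10 := hg 1 0
  have h20 := hg 2 0
  have h30 := hg 3 0
  have h40 := hg 4 0
  have h21 := hg 2 1
  have h31 := hg 3 1
  have h41 := hg 4 1
  have h32 := hg 3 2
  have h42 := hg 4 2
  have h43 := hg 4 3
  interval_cases j <;>
    simp [E, mm, gstep, t2, t3, t4, h10, h20, h30, h40, h21, h31, h41, h32, h42, h43] <;> ring


theorem gstep_symm (g : ℕ → ℕ → ℤ) (hg : ∀ i j, g i j = g j i) (j : ℕ) (t : ℤ) (a b : ℕ) :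
    gstep g j t a b = gstep g j t b a := by
  unfold gstep
  split_ifs <;> first | rfl | omega | (simp only [hg])

/-- The parity obstruction. -/
theorem parity (a0 a1 a2 b0 b1 b2 p q r x y x3 y3 z3 x4 y4 z4 : ZMod 2)
    (hd : p * r - q * q = 1)
    (ha0 : a0 * p + a1 * q + a2 * x = 0) (ha1 : a0 * q + a1 * r + a2 * y = 0)
    (hb0 : b0 * p + b1 * q + b2 * x = 0) (hb1 : b0 * q + b1 * r + b2 * y = 0)
    (ha3 : a0 * x3 + a1 * y3 + a2 * z3 = 1) (ha4 : a0 * x4 + a1 * y4 + a2 * z4 = 0)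
    (hb3 : b0 * x3 + b1 * y3 + b2 * z3 = 0) (hb4 : b0 * x4 + b1 * y4 + b2 * z4 = 1) : False := by
  have e1 : a0 = a2 * (q * y - r * x) := by linear_combination r * ha0 - q * ha1 - a0 * hd
  have e2 : a1 = a2 * (q * x - p * y) := by linear_combination p * ha1 - q * ha0 - a1 * hd
  have e3 : b0 = b2 * (q * y - r * x) := by linear_combination r * hb0 - q * hb1 - b0 * hd
  have e4 : b1 = b2 * (q * x - p * y) := by linear_combination p * hb1 - q * hb0 - b1 * hd
  subst e1 e2 e3 e4
  have : (1 : ZMod 2) = 0 := by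
    linear_combination (-1 : ZMod 2) * (b2 * ((q * y - r * x) * x4 + (q * x - p * y) * y4 + z4)) * ha3
      - hb4 + (b2 * ((q * y - r * x) * x3 + (q * x - p * y) * y3 + z3)) * ha4
  exact absurd this (by decide)

theorem reduce_ineq {D P m : ℤ} (hD : 0 < D) (h : ∀ t : ℤ, D ^ 2 ≤ P + (m + t * D) ^ 2) :
    3 * D ^ 2 ≤ 4 * P := by
  have h1 := Int.emod_nonneg (2 * m + D) (by omega : 2 * D ≠ 0)
  have h2 := Int.emod_lt_of_pos (2 * m + D) (by omega : 0 < 2 * D)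
  have h3 := Int.emod_add_mul_ediv (2 * m + D) (2 * D)
  have h4 := h (-((2 * m + D) / (2 * D)))
  set s := (2 * m + D) / (2 * D)
  set r := (2 * m + D) % (2 * D)
  have h5 : 2 * (m + -s * D) = r - D := by linear_combination -h3
  have h6 : (2 * (m + -s * D)) ^ 2 ≤ D ^ 2 := by
    rw [h5]; nlinarith
  nlinarith

theorem num2 {a b : ℤ} (ha : 0 < a) (h1 : 3 * a ^ 2 ≤ 4 * b) (h : b < a) : a = 1 := by
  nlinarith

theorem num3 {a b c : ℤ} (ha : 0 < a) (hb : 0 < b) (h1 : 3 * a ^ 2 ≤ 4 * b)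
    (h2 : 3 * b ^ 2 ≤ 4 * (c * a)) (h : c < b) : a = 1 := by
  have e2 : 3 * b < 4 * a := by nlinarith
  have e1 : 9 * a < 16 := by nlinarith
  omega

theorem num4 {a b c d : ℤ} (ha : 0 < a) (hb : 0 < b) (hc : 0 < c) (h1 : 3 * a ^ 2 ≤ 4 * b)
    (h2 : 3 * b ^ 2 ≤ 4 * (c * a)) (h3 : 3 * c ^ 2 ≤ 4 * (d * b)) (h : d < c) : a = 1 := by
  have e3 : 3 * c < 4 * b := by nlinarith
  have e2 : 9 * b < 16 * a := by nlinarith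
  have e1 : 27 * a < 64 := by nlinarith
  have : a ≤ 2 := by omega
  have : b ≤ 3 := by omega
  have : c ≤ 3 := by omega
  interval_cases a <;> interval_cases b <;> interval_cases c <;> omega

theorem num5 {a b c d e : ℤ} (ha : 0 < a) (hb : 0 < b) (hc : 0 < c) (hd : 0 < d)
    (h1 : 3 * a ^ 2 ≤ 4 * b)
    (h2 : 3 * b ^ 2 ≤ 4 * (c * a)) (h3 : 3 * c ^ 2 ≤ 4 * (d * b)) (h4 : 3 * d ^ 2 ≤ 4 * (e * c))
    (h : e < d) : a = 1 ∨ (b = 3 ∧ c = 4 ∧ d = 4 ∧ e = 3) := by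
  have e4 : 3 * d < 4 * c := by nlinarith
  have e3 : 9 * c < 16 * b := by nlinarith
  have e2 : 27 * b < 64 * a := by nlinarith
  have e1 : 81 * a < 256 := by nlinarith
  have : a ≤ 3 := by omega
  have : b ≤ 7 := by omega
  have : c ≤ 12 := by omega
  have : d ≤ 16 := by omega
  interval_cases a
  · left; rfl
  all_goals right
  all_goals interval_cases b <;> (try omega) <;> interval_cases c <;> (try omega) <;>
    interval_cases d <;> omega

theorem exceptional (g : ℕ → ℕ → ℤ) (hg : ∀ i j, g i j = g j i)
    (h2 : E g 2 = 3) (h3 : E g 3 = 4) (h4 : E g 4 = 4) (h5 : E g 5 = 3)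
    (hr : ∀ t : ℤ, E g 4 ^ 2 ≤ E g 5 * E g 3 + (mm g 4 + t * E g 4) ^ 2) : False := by
  have hs := E_step_eq g hg 3 (by norm_num) 0
  have h5' := E_step_ne g hg 3 (by norm_num) 0 5 (by norm_num) (by norm_num)
  have hsym := gstep_symm g hg 3 0
  have cg := fun i hi => cof_mul g hg 4 i (by norm_num) hi
  have cg' := fun i hi => cof_mul (gstep g 3 0) hsym 4 i (by norm_num) hi
  have l1 := cof_last g 4 (by norm_num)
  have l2 := cof_last (gstep g 3 0) 4 (by norm_num)
  have l3 : cof g 5 3 = - mm g 4 := rfl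
  have l4 : cof (gstep g 3 0) 5 3 = - mm g 4 := by
    simp [cof, mm, gstep, t4, t3, t2]; ring
  norm_num only [Nat.reduceAdd] at hs cg cg' l1 l2
  rw [h3, h4, h5] at hr
  rw [h3, h4, h5] at hs
  have hm : mm g 4 % 4 = 2 := by
    have a1 := hr (-((mm g 4 + 1) / 4))
    have a2 : -1 ≤ mm g 4 + -((mm g 4 + 1) / 4) * 4 := by omega
    have a3 : mm g 4 + -((mm g 4 + 1) / 4) * 4 ≤ 2 := by omega
    generalize hz : mm g 4 + -((mm g 4 + 1) / 4) * 4 = z at *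
    interval_cases z <;> omega
  obtain ⟨w, hw⟩ : ∃ w, mm g 4 = 4 * w + 2 := ⟨mm g 4 / 4, by omega⟩
  rw [hw] at hs l3 l4
  have hs' : E (gstep g 3 0) 4 = 2 * (2 + 2 * w ^ 2 + 2 * w) := by linarith
  rw [hs'] at l2
  rw [h4] at l1
  have b0 := cg 0 (by norm_num)
  have b1 := cg 1 (by norm_num)
  have b3 := cg 3 (by norm_num)
  have b4 := cg 4 (by norm_num)
  have a0 := cg' 0 (by norm_num)
  have a1 := cg' 1 (by norm_num)
  have a3 := cg' 3 (by norm_num)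
  have a4 := cg' 4 (by norm_num)
  rw [h5'] at a4
  rw [h5] at a4 b4
  rw [l1, l3] at b0 b1 b3 b4
  rw [l2, l4] at a0 a1 a3 a4
  generalize cof g 5 0 = B0 at *
  generalize cof g 5 1 = B1 at *
  generalize cof g 5 2 = B2 at *
  generalize cof (gstep g 3 0) 5 0 = A0 at *
  generalize cof (gstep g 3 0) 5 1 = A1 at *
  generalize cof (gstep g 3 0) 5 2 = A2 at *
  simp [gstep] at a0 a1 a3 a4
  simp only [E, t2] at h2
  norm_num at b0 b1 b3 b4
  rw [hg 1 0, hg 2 0] at a0 b0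
  rw [hg 2 1] at a1 b1
  have two : (2 : ZMod 2) = 0 := rfl
  have cast {x y : ℤ} (h : x = y) : (x : ZMod 2) = (y : ZMod 2) := by rw [h]
  replace h2 := cast h2
  replace a0 := cast a0
  replace a1 := cast a1
  replace a3 := cast a3
  replace a4 := cast a4
  replace b0 := cast b0
  replace b1 := cast b1
  replace b3 := cast b3
  replace b4 := cast b4
  have three : (3 : ZMod 2) = 1 := rfl
  have four : (4 : ZMod 2) = 0 := rfl
  push_cast at h2 a0 a1 a3 a4 b0 b1 b3 b4
  simp only [two, three, four, zero_mul, add_zero, zero_add, neg_zero, mul_zero]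
    at h2 a0 a1 a3 a4 b0 b1 b3 b4
  exact parity A0 A1 A2 B0 B1 B2 (g 0 0) (g 0 1) (g 1 1) (g 0 2) (g 1 2) (g 0 3) (g 1 3) (g 2 3)
    (g 0 4) (g 1 4) (g 2 4) h2 a0 a1 b0 b1 a4 a3 b3 b4


section
variable {M : Type*} [AddCommGroup M]

/-- Gram entries. -/
def gr (B : LinearMap.BilinForm ℤ M) (v : ℕ → M) (i j : ℕ) : ℤ := B (v i) (v j)

structure Sys (B : LinearMap.BilinForm ℤ M) (n : ℕ) (v : ℕ → M) (u : ℕ → M →ₗ[ℤ] ℤ) : Prop where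
  exp : ∀ y z, B y z = u 0 y * B (v 0) z + u 1 y * B (v 1) z + u 2 y * B (v 2) z
    + u 3 y * B (v 3) z + u 4 y * B (v 4) z
  zero : ∀ i, n ≤ i → u i = 0
  pos : ∀ k, k ≤ n → 0 < E (gr B v) k

def vstep (v : ℕ → M) (j : ℕ) (t : ℤ) (i : ℕ) : M :=
  if i = j then v (j + 1) + t • v j else if i = j + 1 then v j else v i

def ustep (u : ℕ → M →ₗ[ℤ] ℤ) (j : ℕ) (t : ℤ) (i : ℕ) : M →ₗ[ℤ] ℤ :=
  if i = j then u (j + 1) else if i = j + 1 then u j - t • u (j + 1) else u i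

theorem gr_symm {B : LinearMap.BilinForm ℤ M} (hB : ∀ x y, B x y = B y x) (v : ℕ → M) (i j : ℕ) :
    gr B v i j = gr B v j i := hB _ _

theorem gr_vstep {B : LinearMap.BilinForm ℤ M} (hB : ∀ x y, B x y = B y x) (v : ℕ → M) (j : ℕ)
    (t : ℤ) : gr B (vstep v j t) = gstep (gr B v) j t := by
  funext a b
  unfold gr vstep gstep
  split_ifs <;> simp <;> (try rw [hB (v (j + 1)) (v j)]) <;> ring

theorem sys_step {B : LinearMap.BilinForm ℤ M} (hB : ∀ x y, B x y = B y x) {n : ℕ} (hn : n ≤ 5)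
    {v : ℕ → M} {u : ℕ → M →ₗ[ℤ] ℤ} (h : Sys B n v u) (j : ℕ) (hj : j + 1 < n) (t : ℤ) :
    Sys B n (vstep v j t) (ustep u j t) := by
  refine ⟨fun y z => ?_, fun i hi => ?_, fun k hk => ?_⟩
  · rw [h.exp y z]
    have : j < 4 := by omega
    interval_cases j <;> simp [vstep, ustep] <;> ring
  · have h1 : i ≠ j := by omega
    have h2 : i ≠ j + 1 := by omega
    simp [ustep, h1, h2, h.zero i hi]
  · rw [gr_vstep hB]
    by_cases hk' : k = j + 1
    · subst hk'
      have e := E_step_eq (gr B v) (gr_symm hB v) j (by omega) t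
      have p1 := h.pos (j + 1) (by omega)
      have p2 := h.pos (j + 2) (by omega)
      have p3 := h.pos j (by omega)
      refine pos_of_mul_pos_left (b := E (gr B v) (j + 1)) ?_ p1.le
      rw [e]; positivity
    · rw [E_step_ne _ (gr_symm hB v) j (by omega) t k (by omega) hk']
      exact h.pos k hk

theorem exists_reduced {B : LinearMap.BilinForm ℤ M} (hB : ∀ x y, B x y = B y x) {n : ℕ}
    (hn : n ≤ 5) (h : ∃ v u, Sys B n v u) :
    ∃ v u, Sys B n v u ∧ ∀ j, j + 1 < n → ∀ t : ℤ, E (gr B v) (j + 1) ^ 2 ≤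
      E (gr B v) (j + 2) * E (gr B v) j + (mm (gr B v) (j + 1) + t * E (gr B v) (j + 1)) ^ 2 := by
  obtain ⟨v, u, h⟩ := h
  obtain ⟨⟨v, u⟩, h1, h2⟩ := exists_minimalFor_of_wellFoundedLT
    (fun p : (ℕ → M) × (ℕ → M →ₗ[ℤ] ℤ) => Sys B n p.1 p.2)
    (fun p => ∑ k ∈ Finset.range n, (E (gr B p.1) k).toNat) ⟨(v, u), h⟩
  refine ⟨v, u, h1, fun j hj t => ?_⟩
  by_contra hcon
  push Not at hcon
  have e := E_step_eq (gr B v) (gr_symm hB v) j (by omega) t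
  rw [← e] at hcon
  have p1 : 0 < E (gr B v) (j + 1) := h1.pos (j + 1) (by omega)
  have hs := sys_step hB hn h1 j hj t
  have lt : E (gstep (gr B v) j t) (j + 1) < E (gr B v) (j + 1) := by
    rw [pow_two] at hcon
    exact lt_of_mul_lt_mul_right hcon p1.le
  have key : ∑ k ∈ Finset.range n, (E (gr B (vstep v j t)) k).toNat
      < ∑ k ∈ Finset.range n, (E (gr B v) k).toNat := by
    rw [gr_vstep hB]
    apply Finset.sum_lt_sum
    · intro k hk
      rw [Finset.mem_range] at hk
      by_cases hk' : k = j + 1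
      · subst hk'; omega
      · rw [E_step_ne _ (gr_symm hB v) j (by omega) t k (by omega) hk']
    · exact ⟨j + 1, Finset.mem_range.2 hj, by omega⟩
  have := h2 (j := (vstep v j t, ustep u j t)) hs key.le
  exact absurd key (not_lt.2 this)

/-- cofactor vector -/
def cv (B : LinearMap.BilinForm ℤ M) (v : ℕ → M) (k : ℕ) : M :=
  cof (gr B v) k 0 • v 0 + cof (gr B v) k 1 • v 1 + cof (gr B v) k 2 • v 2
    + cof (gr B v) k 3 • v 3 + cof (gr B v) k 4 • v 4

theorem cv_apply {B : LinearMap.BilinForm ℤ M} (hB : ∀ x y, B x y = B y x) (v : ℕ → M)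
    (k i : ℕ) (hk : k < 5) (hi : i ≤ k) :
    B (cv B v (k + 1)) (v i) = if i = k then E (gr B v) (k + 1) else 0 := by
  rw [← cof_mul (gr B v) (gr_symm hB v) k i hk hi]
  simp [cv, gr]

theorem cv_self {B : LinearMap.BilinForm ℤ M} (hB : ∀ x y, B x y = B y x) (v : ℕ → M)
    (k : ℕ) (hk : k < 5) :
    B (cv B v (k + 1)) (cv B v (k + 1)) = E (gr B v) (k + 1) * E (gr B v) k := by
  have key : ∀ i, cof (gr B v) (k + 1) i * B (cv B v (k + 1)) (v i)
      = if i = k then E (gr B v) (k + 1) * E (gr B v) k else 0 := by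
    intro i
    rcases lt_or_ge k i with h | h
    · rw [cof_big _ k i hk h, if_neg (by omega), zero_mul]
    · rw [cv_apply hB v k i hk h]
      split_ifs with h'
      · subst h'; rw [cof_last _ _ hk, mul_comm]
      · simp
  conv_lhs => arg 2; rw [cv]
  simp only [map_add, map_smul, smul_eq_mul, key]
  interval_cases k <;> simp

theorem exists_form_of_le {B : LinearMap.BilinForm ℤ M} (hB : ∀ x y, B x y = B y x)
    (hp : ∀ x, 0 ≤ B x x) {n : ℕ} (hn : n < 5) {v u} (h : Sys B (n + 1) v u)
    (hle : E (gr B v) n ≤ E (gr B v) (n + 1)) :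
    ∃ l : M →ₗ[ℤ] ℤ, l ≠ 0 ∧ ∀ y, l y ^ 2 ≤ B y y := by
  have hD := h.pos (n + 1) le_rfl
  have hD' := h.pos n (by omega)
  have key : ∀ y, B y (cv B v (n + 1)) = E (gr B v) (n + 1) * u n y := by
    intro y
    have k1 : ∀ i, u i y * B (v i) (cv B v (n + 1)) =
        if i = n then E (gr B v) (n + 1) * u n y else 0 := by
      intro i
      rcases lt_or_ge n i with h' | h'
      · rw [h.zero i h', if_neg (by omega)]; simp
      · rw [hB, cv_apply hB v n i hn h']
        split_ifs with h''
        · subst h''; ring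
        · simp
    rw [h.exp]
    simp only [k1]
    interval_cases n <;> simp
  refine ⟨u n, ?_, fun y => ?_⟩
  · intro h0
    have := key (v n)
    rw [hB, cv_apply hB v n n hn le_rfl, h0] at this
    simp at this
    omega
  · have cs := LinearMap.BilinForm.apply_sq_le_of_symm B hp ⟨fun x y => hB x y⟩ y (cv B v (n + 1))
    rw [key, cv_self hB v n hn] at cs
    set D := E (gr B v) (n + 1)
    set D' := E (gr B v) n
    have : D * (D * u n y ^ 2) ≤ D * (D' * B y y) := by linarith
    have h1 := le_of_mul_le_mul_left this hD
    have h2 : D' * B y y ≤ D * B y y := mul_le_mul_of_nonneg_right hle (hp y)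
    exact le_of_mul_le_mul_left (h1.trans h2) hD

theorem exists_form_of_one {B : LinearMap.BilinForm ℤ M} (hB : ∀ x y, B x y = B y x)
    (hp : ∀ x, 0 ≤ B x x) {w : M} (hw : B w w = 1) :
    ∃ l : M →ₗ[ℤ] ℤ, l ≠ 0 ∧ ∀ y, l y ^ 2 ≤ B y y := by
  refine ⟨B w, fun h => ?_, fun y => ?_⟩
  · rw [h] at hw; simp at hw
  · have := LinearMap.BilinForm.apply_sq_le_of_symm B hp ⟨fun x y => hB x y⟩ w y
    rwa [hw, one_mul] at this

theorem exists_form_of_sys {B : LinearMap.BilinForm ℤ M} (hB : ∀ x y, B x y = B y x)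
    (hp : ∀ x, 0 ≤ B x x) {n : ℕ} (hn : n < 5) (h : ∃ v u, Sys B (n + 1) v u) :
    ∃ l : M →ₗ[ℤ] ℤ, l ≠ 0 ∧ ∀ y, l y ^ 2 ≤ B y y := by
  obtain ⟨v, u, h, hr⟩ := exists_reduced hB (by omega) h
  rcases le_or_gt (E (gr B v) n) (E (gr B v) (n + 1)) with hle | hlt
  · exact exists_form_of_le hB hp hn h hle
  have hq : ∀ j, j < n → 3 * E (gr B v) (j + 1) ^ 2 ≤ 4 * (E (gr B v) (j + 2) * E (gr B v) j) :=
    fun j hj => reduce_ineq (h.pos _ (by omega)) (hr j (by omega))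
  have e0 : E (gr B v) 0 = 1 := rfl
  have one : E (gr B v) 1 = 1 → ∃ l : M →ₗ[ℤ] ℤ, l ≠ 0 ∧ ∀ y, l y ^ 2 ≤ B y y :=
    fun h1 => exists_form_of_one hB hp (w := v 0) h1
  interval_cases n
  · have := h.pos 1 (by norm_num)
    norm_num at hlt
    omega
  · have q0 := hq 0 (by norm_num)
    norm_num [e0] at q0 hlt
    exact one (num2 (h.pos 1 (by norm_num)) q0 hlt)
  · have q0 := hq 0 (by norm_num)
    have q1 := hq 1 (by norm_num)
    norm_num [e0] at q0 q1 hlt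
    exact one (num3 (h.pos 1 (by norm_num)) (h.pos 2 (by norm_num)) q0 q1 hlt)
  · have q0 := hq 0 (by norm_num)
    have q1 := hq 1 (by norm_num)
    have q2 := hq 2 (by norm_num)
    norm_num [e0] at q0 q1 q2 hlt
    exact one (num4 (h.pos 1 (by norm_num)) (h.pos 2 (by norm_num)) (h.pos 3 (by norm_num))
      q0 q1 q2 hlt)
  · have q0 := hq 0 (by norm_num)
    have q1 := hq 1 (by norm_num)
    have q2 := hq 2 (by norm_num)
    have q3 := hq 3 (by norm_num)
    norm_num [e0] at q0 q1 q2 q3 hlt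
    rcases num5 (h.pos 1 (by norm_num)) (h.pos 2 (by norm_num)) (h.pos 3 (by norm_num))
      (h.pos 4 (by norm_num)) q0 q1 q2 q3 hlt with h1 | ⟨h2, h3, h4, h5⟩
    · exact one h1
    · exact (exceptional (gr B v) (gr_symm hB v) h2 h3 h4 h5 (hr 3 (by norm_num))).elim

/-- A starting system coming from a basis of the quotient by the radical. -/
theorem exists_sys [Module.Finite ℤ M] {B : LinearMap.BilinForm ℤ M} (hB : ∀ x y, B x y = B y x)
    (hp : ∀ x, 0 ≤ B x x) (hr : Module.finrank ℤ M ≤ 5) :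
    ∃ n ≤ 5, ∃ v u, Sys B n v u := by
  set K : Submodule ℤ M := LinearMap.ker B with hK
  have tf : Module.IsTorsionFree ℤ (M ⧸ K) := by
    rw [Module.isTorsionFree_iff_smul_eq_zero]
    intro r x hx
    obtain ⟨y, rfl⟩ := K.mkQ_surjective x
    rw [← map_smul] at hx
    simp only [Submodule.mkQ_apply, Submodule.Quotient.mk_eq_zero] at hx ⊢
    rw [hK, LinearMap.mem_ker, map_smul, smul_eq_zero] at hx
    exact hx
  have fr : Module.Free ℤ (M ⧸ K) := Module.free_of_finite_type_torsion_free'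
  set n := Module.finrank ℤ (M ⧸ K) with hn
  have hn5 : n ≤ 5 := (Submodule.finrank_quotient_le K).trans hr
  let b := Module.finBasis ℤ (M ⧸ K)
  choose f hf using K.mkQ_surjective
  let v : ℕ → M := fun i => if h : i < n then f (b ⟨i, h⟩) else 0
  let u : ℕ → M →ₗ[ℤ] ℤ := fun i => if h : i < n then (b.coord ⟨i, h⟩).comp K.mkQ else 0
  have hv : ∀ i (h : i < n), K.mkQ (v i) = b ⟨i, h⟩ := by
    intro i h; simp only [v, h, dif_pos]; exact hf _
  have huv : ∀ i j, i < n → j < n → u i (v j) = if i = j then 1 else 0 := by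
    intro i j hi hj
    have : u i (v j) = b.coord ⟨i, hi⟩ (K.mkQ (v j)) := by simp only [u, hi, dif_pos]; rfl
    rw [this, hv j hj, Module.Basis.coord_apply, Module.Basis.repr_self, Finsupp.single_apply]
    simp [Fin.ext_iff, eq_comm]
  have huK : ∀ i w, w ∈ K → u i w = 0 := by
    intro i w hw
    by_cases hi : i < n
    · have : u i w = b.coord ⟨i, hi⟩ (K.mkQ w) := by simp only [u, hi, dif_pos]; rfl
      rw [this, Submodule.mkQ_apply, (Submodule.Quotient.mk_eq_zero K).2 hw, map_zero]
    · simp [u, hi]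
  have hu0 : ∀ i, n ≤ i → u i = 0 := by
    intro i hi; simp [u, not_lt.2 hi]
  have hv0 : ∀ i, n ≤ i → v i = 0 := by
    intro i hi; simp [v, not_lt.2 hi]
  have hexp : ∀ y, y - ∑ i ∈ Finset.range 5, u i y • v i ∈ K := by
    intro y
    have e1 : ∑ i ∈ Finset.range 5, u i y • v i = ∑ i ∈ Finset.range n, u i y • v i := by
      symm
      apply Finset.sum_subset
      · intro i; simp only [Finset.mem_range]; omega
      · intro i _ hi
        rw [hu0 i (by simpa using hi)]; simp
    rw [e1, ← Submodule.Quotient.mk_eq_zero, ← Submodule.mkQ_apply, map_sub, sub_eq_zero, map_sum,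
      Finset.sum_range]
    conv_lhs => rw [← b.sum_repr (K.mkQ y)]
    apply Finset.sum_congr rfl
    intro i _
    rw [map_smul, hv i i.2]
    congr 1
    simp [u]
  refine ⟨n, hn5, v, u, fun y z => ?_, hu0, ?_⟩
  · have := hexp y
    rw [hK, LinearMap.mem_ker, map_sub, sub_eq_zero] at this
    rw [this]
    simp [Finset.sum_range_succ]
  · intro k
    induction k with
    | zero => intro _; exact one_pos
    | succ k ih =>
      intro hk
      have ihk := ih (by omega)
      have cs := cv_self hB v k (by omega)
      have nn := hp (cv B v (k + 1))
      rw [cs] at nn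
      have n1 : 0 ≤ E (gr B v) (k + 1) := nonneg_of_mul_nonneg_left nn ihk
      refine lt_of_le_of_ne n1 fun h0 => ?_
      rw [← h0, zero_mul] at cs
      have mem : cv B v (k + 1) ∈ K := by
        rw [hK, LinearMap.mem_ker]
        ext y
        have := LinearMap.BilinForm.apply_sq_le_of_symm B hp ⟨fun x y => hB x y⟩ (cv B v (k + 1)) y
        rw [cs, zero_mul] at this
        simpa using le_antisymm this (sq_nonneg _)
      have z := huK k _ mem
      have key : ∀ i, cof (gr B v) (k + 1) i * u k (v i) = if i = k then E (gr B v) k else 0 := by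
        intro i
        rcases lt_or_ge k i with h | h
        · rw [cof_big _ k i (by omega) h, if_neg (by omega), zero_mul]
        · rw [huv k i (by omega) (by omega)]
          by_cases h' : i = k
          · subst h'; simp [cof_last _ _ (by omega : i < 5)]
          · rw [if_neg (Ne.symm h'), if_neg h', mul_zero]
      simp only [cv, map_add, map_smul, smul_eq_mul, key] at z
      have hk5 : k < 5 := by omega
      have : E (gr B v) k = 0 := by
        rw [← z]
        generalize E (gr B v) k = e
        clear * - hk5
        interval_cases k <;> simp
      omega

theorem exists_form [Module.Finite ℤ M] {B : LinearMap.BilinForm ℤ M} (hB : ∀ x y, B x y = B y x)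
    (hp : ∀ x, 0 ≤ B x x) (hr : Module.finrank ℤ M ≤ 5) (h0 : B ≠ 0) :
    ∃ l : M →ₗ[ℤ] ℤ, l ≠ 0 ∧ ∀ y, l y ^ 2 ≤ B y y := by
  obtain ⟨n, hn, v, u, h⟩ := exists_sys hB hp hr
  rcases n with _ | n
  · exfalso
    apply h0
    ext y z
    rw [h.exp]
    simp [h.zero]
  · exact exists_form_of_sys hB hp (by omega) ⟨v, u, h⟩

end

theorem decomp (n : ℕ) (hn : n ≤ 5) (N : ℕ) : ∀ (X : Matrix (Fin n) (Fin n) ℤ),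
    (∀ i j, X i j = X j i) → (∀ y : Fin n → ℤ, 0 ≤ Matrix.toBilin' X y y) → X.trace ≤ N →
    ∃ (k : ℕ) (x : Fin k → Fin n → ℤ), X = ∑ i : Fin k, Matrix.vecMulVec (x i) (x i) := by
  induction N using Nat.strong_induction_on with
  | _ N ih =>
  intro X hs hp hN
  by_cases hX : X = 0
  · exact ⟨0, Fin.elim0, by simp [hX]⟩
  have hB : ∀ x y, Matrix.toBilin' X x y = Matrix.toBilin' X y x := by
    intro x y
    rw [Matrix.toBilin'_apply, Matrix.toBilin'_apply, Finset.sum_comm]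
    refine Finset.sum_congr rfl fun i _ => Finset.sum_congr rfl fun j _ => ?_
    rw [hs i j]; ring
  obtain ⟨l, hl, hle⟩ := exists_form hB hp (by simpa using hn) (by simpa using hX)
  let x : Fin n → ℤ := fun i => l (Pi.single i 1)
  have hlx : ∀ y, l y = ∑ i, x i * y i := by
    intro y
    rw [LinearMap.pi_apply_eq_sum_univ l y]
    refine Finset.sum_congr rfl fun i _ => ?_
    have : (fun j => if i = j then (1 : ℤ) else 0) = Pi.single i 1 := by
      funext j; simp [Pi.single_apply, eq_comm]
    rw [this, smul_eq_mul, mul_comm]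
  have hvv : ∀ y, Matrix.toBilin' (vecMulVec x x) y y = l y ^ 2 := by
    intro y
    rw [Matrix.toBilin'_apply, hlx, pow_two, Finset.sum_mul_sum]
    refine Finset.sum_congr rfl fun i _ => Finset.sum_congr rfl fun j _ => ?_
    rw [vecMulVec_apply]; ring
  have hp' : ∀ y : Fin n → ℤ, 0 ≤ Matrix.toBilin' (X - vecMulVec x x) y y := by
    intro y
    rw [map_sub, LinearMap.sub_apply, LinearMap.sub_apply, hvv]
    linarith [hle y]
  have tr0 : 0 ≤ (X - vecMulVec x x).trace := by
    apply Finset.sum_nonneg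
    intro i _
    have := hp' (Pi.single i 1)
    rwa [Matrix.toBilin'_single] at this
  have trx : 0 < (vecMulVec x x).trace := by
    obtain ⟨i, hi⟩ : ∃ i, x i ≠ 0 := by
      by_contra hcon
      push Not at hcon
      apply hl
      ext y
      simpa [x] using hcon y
    apply Finset.sum_pos'
    · intro i _; exact mul_self_nonneg _
    · exact ⟨i, Finset.mem_univ _, by
        rw [diag_apply, vecMulVec_apply]; exact mul_self_pos.2 hi⟩
  have tre : (X - vecMulVec x x).trace = X.trace - (vecMulVec x x).trace := Matrix.trace_sub _ _
  obtain ⟨k, z, hz⟩ := ih (X - vecMulVec x x).trace.toNat (by omega) (X - vecMulVec x x)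
    (fun i j => by rw [Matrix.sub_apply, Matrix.sub_apply, vecMulVec_apply, vecMulVec_apply, hs i j, mul_comm])
    hp' (by omega)
  refine ⟨k + 1, Fin.cons x z, ?_⟩
  rw [Fin.sum_univ_succ]
  simp only [Fin.cons_zero, Fin.cons_succ]
  rw [← hz]; abel

end IntRankOne

/-- For `1 ≤ n ≤ 5`, every `n × n` positive semidefinite matrix with
integer entries admits an integer rank-1 decomposition `X = ∑ xᵢ xᵢᵀ`. -/
theorem psd_integer_rank_one_decomposition_of_dim_le_five
    (n : ℕ) (h1 : 1 ≤ n) (h5 : n ≤ 5)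
    (X : Matrix (Fin n) (Fin n) ℤ)
    (hX : (X.map (Int.cast : ℤ → ℝ)).PosSemidef) :
    ∃ (k : ℕ) (x : Fin k → Fin n → ℤ),
      X = ∑ i : Fin k, Matrix.vecMulVec (x i) (x i) := by
  refine IntRankOne.decomp n h5 X.trace.toNat X (fun i j => ?_) (fun y => ?_) (by omega)
  · have := hX.1.apply j i
    simpa using this
  · have := hX.dotProduct_mulVec_nonneg (fun i => (y i : ℝ))
    rw [Matrix.toBilin'_apply]
    have e : ((∑ i, ∑ j, y i * X i j * y j : ℤ) : ℝ) =
        star (fun i => (y i : ℝ)) ⬝ᵥ (X.map (Int.cast : ℤ → ℝ)) *ᵥ (fun i => (y i : ℝ)) := by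
      push_cast
      simp [dotProduct, mulVec, Finset.mul_sum, mul_assoc]
    rw [← e] at this
    exact_mod_cast this
end

section
/- Let n = 6 and let M be the 6×6 integer matrix with rows (2,0,1,1,1,1), (0,2,0,1,1,1), (1,0,2,1,1,1), (1,1,1,2,1,1), (1,1,1,1,2,1), (1,1,1,1,1,2). For every X ∈ S^6_+(ℤ) there exist a finite index set K, vectors x_i ∈ ℤ⁶ for i ∈ K, and a matrix Y which is either the zero matrix or unimodularly equivalent to M, such that X = Σ_{i∈K} x_i x_iᵀ + Y. -/
open Matrix

/-- Mordell's `6 × 6` matrix. -/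
def mordellM : Matrix (Fin 6) (Fin 6) ℤ :=
  !![2, 0, 1, 1, 1, 1;
     0, 2, 0, 1, 1, 1;
     1, 0, 2, 1, 1, 1;
     1, 1, 1, 2, 1, 1;
     1, 1, 1, 1, 2, 1;
     1, 1, 1, 1, 1, 2]


/-- The rational version of an integer matrix. -/
def qm {n : ℕ} (X : Matrix (Fin n) (Fin n) ℤ) : Matrix (Fin n) (Fin n) ℚ :=
  X.map (Int.cast : ℤ → ℚ)

/-- The quadratic form. -/
def nrm {n : ℕ} (X : Matrix (Fin n) (Fin n) ℤ) (y : Fin n → ℚ) : ℚ := y ⬝ᵥ (qm X *ᵥ y)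

/-- Rational coordinates of vectors in the dual lattice. -/
def IsDual {n : ℕ} (X : Matrix (Fin n) (Fin n) ℤ) (y : Fin n → ℚ) : Prop :=
  ∃ z : Fin n → ℤ, qm X *ᵥ y = fun i => (z i : ℚ)

def PSDQ {n : ℕ} (X : Matrix (Fin n) (Fin n) ℤ) : Prop := Xᵀ = X ∧ ∀ y, 0 ≤ nrm X y

def PDQ {n : ℕ} (X : Matrix (Fin n) (Fin n) ℤ) : Prop := Xᵀ = X ∧ ∀ y, y ≠ 0 → 0 < nrm X y

/-- Dual minimum larger than `c`, and no vectors of norm one. -/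
def Good {n : ℕ} (c : ℚ) (X : Matrix (Fin n) (Fin n) ℤ) : Prop :=
  (∀ y, y ≠ 0 → IsDual X y → c < nrm X y) ∧ ∀ v : Fin n → ℤ, v ⬝ᵥ (X *ᵥ v) ≠ 1

def Eqv {n : ℕ} (X Y : Matrix (Fin n) (Fin n) ℤ) : Prop :=
  ∃ U V : Matrix (Fin n) (Fin n) ℤ, U * V = 1 ∧ Y = U * X * Uᵀ

/-- Matrix in block form, with first row and column singled out. -/
def blk {R : Type} {n : ℕ} (a : R) (r c : Fin n → R) (M : Matrix (Fin n) (Fin n) R) :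
    Matrix (Fin (n+1)) (Fin (n+1)) R :=
  fun i j => Fin.cases (Fin.cases a r j) (fun i => Fin.cases (c i) (M i) j) i

section basics
variable {n : ℕ}

theorem blk_mul {R : Type} [CommRing R] (a a' : R) (r c r' c' : Fin n → R) (M M' : Matrix (Fin n) (Fin n) R) :
    blk a r c M * blk a' r' c' M' =
      blk (a * a' + r ⬝ᵥ c') (a • r' + r ᵥ* M') (a' • c + M *ᵥ c') (vecMulVec c r' + M * M') := by
  ext i j
  refine Fin.cases ?_ (fun i => ?_) i <;> refine Fin.cases ?_ (fun j => ?_) j <;>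
    simp [blk, Matrix.mul_apply, Fin.sum_univ_succ, dotProduct, vecMul, mulVec, vecMulVec, mul_comm]

theorem blk_transpose {R : Type} (a : R) (r c : Fin n → R) (M : Matrix (Fin n) (Fin n) R) :
    (blk a r c M)ᵀ = blk a c r Mᵀ := by
  ext i j
  refine Fin.cases ?_ (fun i => ?_) i <;> refine Fin.cases ?_ (fun j => ?_) j <;>
    simp [blk]

theorem blk_one {R : Type} [CommRing R] : blk (1 : R) 0 0 (1 : Matrix (Fin n) (Fin n) R) = 1 := by
  ext i j
  refine Fin.cases ?_ (fun i => ?_) i <;> refine Fin.cases ?_ (fun j => ?_) j <;>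
    simp [blk, Matrix.one_apply, Fin.succ_ne_zero, (Fin.succ_ne_zero _).symm]

theorem blk_eta {R : Type} (X : Matrix (Fin (n+1)) (Fin (n+1)) R) :
    X = blk (X 0 0) (fun j => X 0 j.succ) (fun i => X i.succ 0) (fun i j => X i.succ j.succ) := by
  ext i j
  refine Fin.cases ?_ (fun i => ?_) i <;> refine Fin.cases ?_ (fun j => ?_) j <;>
    simp [blk]

theorem blk_mulVec {R : Type} [CommRing R] (a : R) (r c : Fin n → R) (M : Matrix (Fin n) (Fin n) R)
    (x : R) (v : Fin n → R) :
    blk a r c M *ᵥ (Fin.cons x v : Fin (n+1) → R) = (Fin.cons (a * x + r ⬝ᵥ v) (x • c + M *ᵥ v) : Fin (n+1) → R) := by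
  ext i
  refine Fin.cases ?_ (fun i => ?_) i <;>
    simp [blk, mulVec, dotProduct, Fin.sum_univ_succ, mul_comm]

theorem cons_dot {R : Type} [CommRing R] (x x' : R) (v v' : Fin n → R) :
    (Fin.cons x v : Fin (n+1) → R) ⬝ᵥ (Fin.cons x' v' : Fin (n+1) → R) = x * x' + v ⬝ᵥ v' := by
  simp [dotProduct, Fin.sum_univ_succ]

theorem qm_blk (a : ℤ) (r c : Fin n → ℤ) (M : Matrix (Fin n) (Fin n) ℤ) :
    qm (blk a r c M) = blk (a : ℚ) (fun i => (r i : ℚ)) (fun i => (c i : ℚ)) (qm M) := by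
  ext i j
  refine Fin.cases ?_ (fun i => ?_) i <;> refine Fin.cases ?_ (fun j => ?_) j <;>
    simp [blk, qm]

theorem qm_mul (X Y : Matrix (Fin n) (Fin n) ℤ) : qm (X * Y) = qm X * qm Y := by
  ext i j; simp [qm, Matrix.mul_apply]

theorem qm_transpose (X : Matrix (Fin n) (Fin n) ℤ) : qm Xᵀ = (qm X)ᵀ := by
  ext i j; simp [qm]

theorem qm_one : qm (1 : Matrix (Fin n) (Fin n) ℤ) = 1 := by
  ext i j; simp [qm, Matrix.one_apply]

theorem qm_mulVec (X : Matrix (Fin n) (Fin n) ℤ) (z : Fin n → ℤ) :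
    qm X *ᵥ (fun i => (z i : ℚ)) = fun i => ((X *ᵥ z) i : ℚ) := by
  ext i; simp [qm, mulVec, dotProduct]

theorem dot_cast (x z : Fin n → ℤ) :
    (fun i => (x i : ℚ)) ⬝ᵥ (fun i => (z i : ℚ)) = ((x ⬝ᵥ z : ℤ) : ℚ) := by
  simp [dotProduct]

theorem nrm_cast (X : Matrix (Fin n) (Fin n) ℤ) (v : Fin n → ℤ) :
    nrm X (fun i => (v i : ℚ)) = ((v ⬝ᵥ (X *ᵥ v) : ℤ) : ℚ) := by
  rw [nrm, qm_mulVec, dot_cast]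

theorem nrm_smul (X : Matrix (Fin n) (Fin n) ℤ) (a : ℚ) (y : Fin n → ℚ) :
    nrm X (a • y) = a ^ 2 * nrm X y := by
  simp [nrm, mulVec_smul]; ring

theorem sym_dot {X : Matrix (Fin n) (Fin n) ℤ} (h : Xᵀ = X) (y z : Fin n → ℚ) :
    y ⬝ᵥ (qm X *ᵥ z) = z ⬝ᵥ (qm X *ᵥ y) := by
  rw [dotProduct_mulVec, ← mulVec_transpose, ← qm_transpose, h, dotProduct_comm]

theorem nrm_add {X : Matrix (Fin n) (Fin n) ℤ} (h : Xᵀ = X) (y z : Fin n → ℚ) :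
    nrm X (y + z) = nrm X y + 2 * (y ⬝ᵥ (qm X *ᵥ z)) + nrm X z := by
  simp only [nrm, mulVec_add, add_dotProduct, dotProduct_add]
  rw [sym_dot h z y]; ring

theorem nrm_conj (X U : Matrix (Fin n) (Fin n) ℤ) (y : Fin n → ℚ) :
    nrm (U * X * Uᵀ) y = nrm X ((qm U)ᵀ *ᵥ y) := by
  simp only [nrm, qm_mul, qm_transpose, ← mulVec_mulVec]
  rw [dotProduct_mulVec, ← mulVec_transpose]

theorem Eqv.refl (X : Matrix (Fin n) (Fin n) ℤ) : Eqv X X := ⟨1, 1, by simp, by simp⟩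

theorem Eqv.symm {X Y : Matrix (Fin n) (Fin n) ℤ} (h : Eqv X Y) : Eqv Y X := by
  obtain ⟨U, V, h1, rfl⟩ := h
  have h2 : V * U = 1 := mul_eq_one_comm.mp h1
  refine ⟨V, U, h2, ?_⟩
  have h3 : Uᵀ * Vᵀ = 1 := by rw [← transpose_mul, h2, transpose_one]
  calc X = (V * U) * X * (Uᵀ * Vᵀ) := by rw [h2, h3]; simp
    _ = _ := by simp only [Matrix.mul_assoc]

theorem Eqv.trans {X Y Z : Matrix (Fin n) (Fin n) ℤ} (h : Eqv X Y) (h' : Eqv Y Z) : Eqv X Z := by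
  obtain ⟨U, V, h1, rfl⟩ := h
  obtain ⟨U', V', h1', rfl⟩ := h'
  refine ⟨U' * U, V * V', ?_, ?_⟩
  · calc U' * U * (V * V') = U' * (U * V) * V' := by simp only [Matrix.mul_assoc]
      _ = 1 := by rw [h1]; simp [h1']
  · rw [transpose_mul]; simp only [Matrix.mul_assoc]

theorem conj_sym {X U : Matrix (Fin n) (Fin n) ℤ} (h : Xᵀ = X) : (U * X * Uᵀ)ᵀ = U * X * Uᵀ := by
  simp [transpose_mul, h, Matrix.mul_assoc]

theorem tr_ne {U V : Matrix (Fin n) (Fin n) ℤ} (h : U * V = 1) {y : Fin n → ℚ} (hy : y ≠ 0) :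
    (qm U)ᵀ *ᵥ y ≠ 0 := by
  intro h0
  apply hy
  have h2 : V * U = 1 := mul_eq_one_comm.mp h
  have : (qm V)ᵀ *ᵥ ((qm U)ᵀ *ᵥ y) = y := by
    rw [mulVec_mulVec, ← transpose_mul, ← qm_mul, h, qm_one, transpose_one, one_mulVec]
  rw [← this, h0, mulVec_zero]

theorem PSDQ.eqv {X Y : Matrix (Fin n) (Fin n) ℤ} (hX : PSDQ X) (h : Eqv X Y) : PSDQ Y := by
  obtain ⟨U, V, h1, rfl⟩ := h
  exact ⟨conj_sym hX.1, fun y => by rw [nrm_conj]; exact hX.2 _⟩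

theorem PDQ.eqv {X Y : Matrix (Fin n) (Fin n) ℤ} (hX : PDQ X) (h : Eqv X Y) : PDQ Y := by
  obtain ⟨U, V, h1, rfl⟩ := h
  exact ⟨conj_sym hX.1, fun y hy => by rw [nrm_conj]; exact hX.2 _ (tr_ne h1 hy)⟩

theorem IsDual.of_conj {X U V : Matrix (Fin n) (Fin n) ℤ} (h1 : U * V = 1) {y : Fin n → ℚ}
    (h : IsDual (U * X * Uᵀ) y) : IsDual X ((qm U)ᵀ *ᵥ y) := by
  have h2 : V * U = 1 := mul_eq_one_comm.mp h1
  obtain ⟨z, hz⟩ := h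
  refine ⟨V *ᵥ z, ?_⟩
  rw [← qm_mulVec, ← hz, mulVec_mulVec, mulVec_mulVec, ← qm_transpose, ← qm_mul, ← qm_mul]
  congr 2
  rw [← Matrix.mul_assoc, ← Matrix.mul_assoc, h2, Matrix.one_mul]

theorem Good.eqv {c : ℚ} {X Y : Matrix (Fin n) (Fin n) ℤ} (hX : Good c X) (h : Eqv X Y) :
    Good c Y := by
  obtain ⟨U, V, h1, rfl⟩ := h
  refine ⟨fun y hy hd => ?_, fun v => ?_⟩
  · rw [nrm_conj]; exact hX.1 _ (tr_ne h1 hy) (hd.of_conj h1)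
  · have := hX.2 (Uᵀ *ᵥ v)
    rwa [← mulVec_mulVec, ← mulVec_mulVec, dotProduct_mulVec, ← mulVec_transpose]

theorem Good.mono {c c' : ℚ} {X : Matrix (Fin n) (Fin n) ℤ} (hX : Good c X) (h : c' ≤ c) :
    Good c' X := ⟨fun y hy hd => h.trans_lt (hX.1 y hy hd), hX.2⟩

/-- Reduction of an integer vector by unimodular operations. -/
theorem exists_reduce (x : Fin (n+1) → ℤ) : ∃ (U V : Matrix (Fin (n+1)) (Fin (n+1)) ℤ) (g : ℤ),
    U * V = 1 ∧ U *ᵥ x = Pi.single 0 g := by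
  induction h : ∑ i, (x i).natAbs using Nat.strong_induction_on generalizing x with
  | _ N ih =>
  by_cases hz : ∀ i j, i ≠ j → x i = 0 ∨ x j = 0
  · by_cases h0 : x = 0
    · exact ⟨1, 1, 0, by simp, by simp [h0]⟩
    · obtain ⟨k, hk⟩ : ∃ k, x k ≠ 0 := by
        by_contra! hc; exact h0 (funext hc)
      have hx : x = Pi.single k (x k) := by
        ext i
        by_cases hik : i = k
        · subst hik; simp
        · rw [Pi.single_eq_of_ne hik]
          exact (hz i k hik).resolve_right hk
      refine ⟨(Equiv.swap 0 k).permMatrix ℤ, (Equiv.swap 0 k).permMatrix ℤ, x k, ?_, ?_⟩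
      · rw [← Matrix.permMatrix_mul]; simp
      · rw [Matrix.permMatrix_mulVec]
        ext i
        rw [hx]
        simp only [Function.comp, Pi.single_apply, if_true]
        congr 1
        rw [Equiv.swap_apply_eq_iff]; simp
  · push Not at hz
    obtain ⟨i, j, hij, hi, hj⟩ := hz
    wlog hle : (x j).natAbs ≤ (x i).natAbs generalizing i j
    · exact this j i hij.symm hj hi (by omega)
    obtain ⟨c, hc⟩ : ∃ c : ℤ, (x i + c * x j).natAbs < (x i).natAbs := by
      rcases lt_or_gt_of_ne hi with h1 | h1 <;> rcases lt_or_gt_of_ne hj with h2 | h2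
      · exact ⟨-1, by omega⟩
      · exact ⟨1, by omega⟩
      · exact ⟨1, by omega⟩
      · exact ⟨-1, by omega⟩
    have hT : transvection i j c *ᵥ x = Function.update x i (x i + c * x j) := by
      ext a
      rw [transvection, add_mulVec, one_mulVec, single_mulVec]
      by_cases hai : a = i
      · subst hai; simp
      · simp [hai]
    obtain ⟨U, V, g, h1, h2⟩ := ih (∑ a, (Function.update x i (x i + c * x j) a).natAbs) (by
      rw [← h]
      apply Finset.sum_lt_sum
      · intro a _
        by_cases hai : a = i
        · subst hai; simpa using hc.le
        · simp [Function.update_of_ne hai]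
      · exact ⟨i, Finset.mem_univ _, by simpa using hc⟩) _ rfl
    refine ⟨U * transvection i j c, transvection i j (-c) * V, g, ?_, ?_⟩
    · calc U * transvection i j c * (transvection i j (-c) * V)
          = U * (transvection i j c * transvection i j (-c)) * V := by simp only [Matrix.mul_assoc]
        _ = 1 := by
          rw [transvection_mul_transvection_same _ _ hij]; simp [h1]
    · rw [← mulVec_mulVec, hT, h2]

theorem PDQ.det_ne {X : Matrix (Fin n) (Fin n) ℤ} (hX : PDQ X) : X.det ≠ 0 := by
  intro h
  obtain ⟨v, hv, h0⟩ := Matrix.exists_mulVec_eq_zero_iff.mpr h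
  have hv' : (fun i => (v i : ℚ)) ≠ 0 := by
    intro h; apply hv; ext i; simpa using congrFun h i
  have := hX.2 _ hv'
  rw [nrm_cast, h0] at this
  simp at this

/-- Existence of shortest dual vectors. -/
theorem exists_min {X : Matrix (Fin (n+1)) (Fin (n+1)) ℤ} (hX : PDQ X) :
    ∃ y, y ≠ 0 ∧ IsDual X y ∧ ∀ y', y' ≠ 0 → IsDual X y' → nrm X y ≤ nrm X y' := by
  have hD : (0 : ℚ) < |(X.det : ℚ)| := by simpa using hX.det_ne
  have key : ∀ y, y ≠ 0 → IsDual X y → ∃ N : ℕ, |(X.det : ℚ)| * nrm X y = N := by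
    intro y hy hd
    have hpos := hX.2 y hy
    obtain ⟨z, hz⟩ := hd
    have h1 : (X.det : ℚ) • y = fun i => ((adjugate X *ᵥ z) i : ℚ) := by
      rw [← qm_mulVec, ← hz, mulVec_mulVec, ← qm_mul, adjugate_mul]
      have : qm (X.det • (1 : Matrix (Fin (n+1)) (Fin (n+1)) ℤ)) = (X.det : ℚ) • 1 := by
        rw [← qm_one]
        ext i j
        simp only [qm, Matrix.map_apply, Matrix.smul_apply, smul_eq_mul, Int.cast_mul]
      rw [this, smul_mulVec, one_mulVec]
    have h2 : (X.det : ℚ) * nrm X y = (((adjugate X *ᵥ z) ⬝ᵥ z : ℤ) : ℚ) := by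
      rw [← dot_cast, ← h1, nrm, hz, smul_dotProduct, smul_eq_mul]
    refine ⟨((adjugate X *ᵥ z) ⬝ᵥ z).natAbs, ?_⟩
    rw [Nat.cast_natAbs, Int.cast_abs, ← h2, abs_mul, abs_of_pos hpos]
  have hex : ∃ N : ℕ, ∃ y, y ≠ 0 ∧ IsDual X y ∧ |(X.det : ℚ)| * nrm X y = N := by
    have h1 : (fun i => ((Pi.single 0 1 : Fin (n+1) → ℤ) i : ℚ)) ≠ 0 := by
      intro h; simpa using congrFun h 0
    have h2 : IsDual X (fun i => ((Pi.single 0 1 : Fin (n+1) → ℤ) i : ℚ)) := ⟨_, qm_mulVec _ _⟩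
    obtain ⟨N, hN⟩ := key _ h1 h2
    exact ⟨N, _, h1, h2, hN⟩
  classical
  obtain ⟨y, hy, hd, hN⟩ := Nat.find_spec hex
  refine ⟨y, hy, hd, fun y' hy' hd' => ?_⟩
  obtain ⟨N', hN'⟩ := key y' hy' hd'
  have := Nat.find_min' hex ⟨y', hy', hd', hN'⟩
  have h3 : |(X.det : ℚ)| * nrm X y ≤ |(X.det : ℚ)| * nrm X y' := by
    rw [hN, hN']; exact_mod_cast this
  exact le_of_mul_le_mul_left h3 hD

end basics
section step
variable {n : ℕ}

theorem nrm_cons0 (s : ℤ) (b b' : Fin n → ℤ) (X : Matrix (Fin n) (Fin n) ℤ) (y : Fin n → ℚ) :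
    nrm (blk s b b' X) (Fin.cons 0 y : Fin (n+1) → ℚ) = nrm X y := by
  rw [nrm, qm_blk, blk_mulVec, cons_dot]; simp [nrm]

theorem cons0_ne {y : Fin n → ℚ} (hy : y ≠ 0) : (Fin.cons 0 y : Fin (n+1) → ℚ) ≠ 0 := by
  intro h; apply hy; ext i; simpa using congrFun h i.succ

theorem blk_sym {s : ℤ} {b b' : Fin n → ℤ} {X : Matrix (Fin n) (Fin n) ℤ}
    (h : (blk s b b' X)ᵀ = blk s b b' X) : b' = b ∧ Xᵀ = X := by
  rw [blk_transpose] at h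
  constructor
  · ext i; simpa [blk] using congrFun (congrFun h 0) i.succ
  · ext i j; simpa [blk] using congrFun (congrFun h i.succ) j.succ

theorem step {c : ℚ} (hc : 0 < c) {X : Matrix (Fin (n+1)) (Fin (n+1)) ℤ} (hX : PDQ X)
    (hG : Good c X) : ∃ (s : ℤ) (b : Fin n → ℤ) (X' : Matrix (Fin n) (Fin n) ℤ),
      Eqv X (blk s b b X') ∧ PDQ X' ∧ Good (3 / 4 * c) X' := by
  obtain ⟨y0, hy0, ⟨z0, hz0⟩, hmin⟩ := exists_min hX
  obtain ⟨U, V, g, hUV, hg⟩ := exists_reduce z0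
  have hE : Eqv X (U * X * Uᵀ) := ⟨U, V, hUV, rfl⟩
  have hY := hX.eqv hE
  have hGY := hG.eqv hE
  have hVU : V * U = 1 := mul_eq_one_comm.mp hUV
  have hinv : (qm U)ᵀ *ᵥ ((qm V)ᵀ *ᵥ y0) = y0 := by
    rw [mulVec_mulVec, ← transpose_mul, ← qm_mul, hVU, qm_one, transpose_one, one_mulVec]
  have h1 : qm (U * X * Uᵀ) *ᵥ ((qm V)ᵀ *ᵥ y0) = fun i => ((Pi.single 0 g : Fin (n+1) → ℤ) i : ℚ) := by
    rw [qm_mul, qm_transpose, ← mulVec_mulVec, hinv, qm_mul, ← mulVec_mulVec, hz0, qm_mulVec, hg]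
  have hn1 : nrm (U * X * Uᵀ) ((qm V)ᵀ *ᵥ y0) = nrm X y0 := by rw [nrm_conj, hinv]
  have hm0 : 0 < nrm X y0 := hX.2 y0 hy0
  have hg0 : g ≠ 0 := by
    rintro rfl
    rw [← hn1, nrm, h1] at hm0
    simp [dotProduct] at hm0
  have hmin' : ∀ y', y' ≠ 0 → IsDual (U * X * Uᵀ) y' →
      nrm (U * X * Uᵀ) ((g : ℚ)⁻¹ • ((qm V)ᵀ *ᵥ y0)) ≤ nrm (U * X * Uᵀ) y' := by
    intro y' hy' hd'
    have h2 := hmin _ (tr_ne hUV hy') (hd'.of_conj hUV)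
    rw [← nrm_conj] at h2
    refine le_trans ?_ h2
    rw [nrm_smul, hn1]
    have h3 : ((g : ℚ)⁻¹) ^ 2 ≤ 1 := by
      rw [inv_pow]
      apply inv_le_one_of_one_le₀
      have : 1 ≤ g ^ 2 := by
        have := sq_nonneg g
        have : g ^ 2 ≠ 0 := pow_ne_zero 2 hg0
        omega
      exact_mod_cast this
    nlinarith
  have hgq : (g : ℚ) ≠ 0 := by exact_mod_cast hg0
  have h1' : qm (U * X * Uᵀ) *ᵥ ((g : ℚ)⁻¹ • ((qm V)ᵀ *ᵥ y0)) = (Fin.cons 1 0 : Fin (n+1) → ℚ) := by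
    rw [mulVec_smul, h1]
    ext i
    refine Fin.cases ?_ (fun i => ?_) i
    · simp [hgq]
    · simp
  have hm1 : 0 < nrm (U * X * Uᵀ) ((g : ℚ)⁻¹ • ((qm V)ᵀ *ᵥ y0)) := by
    rw [nrm_smul, hn1]; positivity
  have hy1 : (g : ℚ)⁻¹ • ((qm V)ᵀ *ᵥ y0) ≠ 0 := by
    intro h; rw [h] at hm1; simp [nrm] at hm1
  generalize (g : ℚ)⁻¹ • ((qm V)ᵀ *ᵥ y0) = y1 at *
  generalize U * X * Uᵀ = Y at *
  have hcm : c < nrm Y y1 := hGY.1 y1 hy1 ⟨Fin.cons 1 0, by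
    rw [h1']; ext i; refine Fin.cases ?_ (fun i => ?_) i <;> simp⟩
  obtain ⟨s, b, b', X', rfl⟩ : ∃ s b b' X', Y = blk s b b' X' := ⟨_, _, _, _, blk_eta Y⟩
  obtain ⟨rfl, hs⟩ := blk_sym hY.1
  have hPD : PDQ X' := ⟨hs, fun y hy => by
    rw [← nrm_cons0 s b' b']; exact hY.2 _ (cons0_ne hy)⟩
  refine ⟨s, b', X', hE, hPD, ?_, ?_⟩
  · intro y' hy' ⟨z', hz'⟩
    set β : ℚ := (fun i => (b' i : ℚ)) ⬝ᵥ y' with hβ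
    have hr := abs_sub_round β
    obtain ⟨ζ, hζ⟩ : ∃ ζ : ℚ, ζ = round β - β := ⟨_, rfl⟩
    have hζ2 : ζ ^ 2 ≤ 1 / 4 := by
      have : |ζ| ≤ 1 / 2 := by rw [hζ, abs_sub_comm]; exact hr
      rw [← sq_abs]; nlinarith [abs_nonneg ζ]
    have e1 : qm (blk s b' b' X') *ᵥ ((Fin.cons 0 y' : Fin (n+1) → ℚ) + ζ • y1) =
        fun i => ((Fin.cons (round β) z' : Fin (n+1) → ℤ) i : ℚ) := by
      rw [mulVec_add, mulVec_smul, h1', qm_blk, blk_mulVec, hz', ← hβ, hζ]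
      ext i
      refine Fin.cases ?_ (fun i => ?_) i <;> simp
    have e2 : nrm (blk s b' b' X') ((Fin.cons 0 y' : Fin (n+1) → ℚ) + ζ • y1) =
        nrm X' y' + ζ ^ 2 * nrm (blk s b' b' X') y1 := by
      rw [nrm_add hY.1, nrm_cons0, nrm_smul, mulVec_smul, h1', dotProduct_smul, cons_dot]
      simp
    have e3 : (Fin.cons 0 y' : Fin (n+1) → ℚ) + ζ • y1 ≠ 0 := by
      intro h
      rw [h, mulVec_zero] at e1
      have hz0 : z' = 0 := by
        ext i
        have := congrFun e1 i.succ
        simp at this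
        exact_mod_cast this.symm
      have := hPD.2 y' hy'
      rw [nrm, hz', hz0] at this
      simp at this
    have e4 := hmin' _ e3 ⟨_, e1⟩
    rw [e2] at e4
    nlinarith
  · intro v
    have := hGY.2 (Fin.cons 0 v : Fin (n+1) → ℤ)
    rw [blk_mulVec, cons_dot] at this
    simpa using this

theorem blk_eqv {X W V : Matrix (Fin n) (Fin n) ℤ} (hX : Xᵀ = X) (hW : W * V = 1) (s : ℤ)
    (b u : Fin n → ℤ) : Eqv (blk s b b X)
      (blk (s + u ⬝ᵥ b + (b + X *ᵥ u) ⬝ᵥ u) (W *ᵥ (b + X *ᵥ u)) (W *ᵥ (b + X *ᵥ u)) (W * X * Wᵀ)) := by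
  refine ⟨blk 1 u 0 W, blk 1 (-(u ᵥ* V)) 0 V, ?_, ?_⟩
  · rw [blk_mul, ← blk_one]
    congr 1 <;> simp [hW]
  · have hux : u ᵥ* X = X *ᵥ u := by rw [← mulVec_transpose, hX]
    rw [blk_mul, blk_transpose, blk_mul, hux]
    congr 1 <;> simp [vecMul_transpose, mulVec_add]

/-- What positivity and goodness say about the last extension step. -/
theorem blk_range {X A : Matrix (Fin n) (Fin n) ℤ} {d : ℤ} (hd : 0 < d) (hA : X * A = d • 1)
    {c : ℚ} {s : ℤ} {r : Fin n → ℤ}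
    (hP : PDQ (blk s r r X)) (hG : Good c (blk s r r X)) :
    r ⬝ᵥ (A *ᵥ r) < d * s ∧ c * (d * s - (r ⬝ᵥ (A *ᵥ r) : ℤ)) < d := by
  set τ : ℤ := d * s - r ⬝ᵥ (A *ᵥ r) with hτ
  have h1 : (blk s r r X) *ᵥ (Fin.cons d (-(A *ᵥ r)) : Fin (n+1) → ℤ) = Fin.cons τ 0 := by
    rw [blk_mulVec]
    congr 1
    · simp [hτ]; ring
    · rw [mulVec_neg, mulVec_mulVec, hA, smul_mulVec, one_mulVec]; simp
  have hne : (fun i => ((Fin.cons d (-(A *ᵥ r)) : Fin (n+1) → ℤ) i : ℚ)) ≠ 0 := by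
    intro h
    have := congrFun h 0
    simp at this
    omega
  have h2 := hP.2 _ hne
  have h3 : nrm (blk s r r X) (fun i => ((Fin.cons d (-(A *ᵥ r)) : Fin (n+1) → ℤ) i : ℚ)) =
      d * τ := by
    rw [nrm_cast, h1, cons_dot]; simp
  rw [h3] at h2
  have h2' : 0 < d * τ := by exact_mod_cast h2
  have hτ0 : 0 < τ := pos_of_mul_pos_right h2' hd.le
  have hτq : (0 : ℚ) < τ := by exact_mod_cast hτ0
  refine ⟨by omega, ?_⟩
  have h4 := hG.1 ((τ : ℚ)⁻¹ • (fun i => ((Fin.cons d (-(A *ᵥ r)) : Fin (n+1) → ℤ) i : ℚ)))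
    (smul_ne_zero (inv_ne_zero hτq.ne') hne) ⟨Fin.cons 1 0, by
      rw [mulVec_smul, qm_mulVec, h1]
      ext i
      refine Fin.cases ?_ (fun i => ?_) i
      · simp [hτq.ne']
      · simp⟩
  rw [nrm_smul, h3] at h4
  have h5 : ((τ : ℚ)⁻¹) ^ 2 * (d * τ) = d / τ := by field_simp
  rw [h5, lt_div_iff₀ hτq] at h4
  have h6 : (τ : ℚ) = d * s - (r ⬝ᵥ (A *ᵥ r) : ℤ) := by rw [hτ]; push_cast; ring
  rw [← h6]; exact h4
end step

/-- Certificates: a short dual vector `y / D`, a unit vector, or an equivalence. -/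
inductive Cert (n : ℕ) : Type
  | short (D : ℤ) (y : Fin n → ℤ)
  | unit (v : Fin n → ℤ)
  | iso (U V : Matrix (Fin n) (Fin n) ℤ)

def Cert.ok {n : ℕ} (p q : ℤ) (L : List (Matrix (Fin n) (Fin n) ℤ)) (X : Matrix (Fin n) (Fin n) ℤ) :
    Cert n → Bool
  | .short D y => decide (0 < D ∧ y ≠ 0 ∧ (∀ i, (X *ᵥ y) i % D = 0) ∧ q * (y ⬝ᵥ (X *ᵥ y)) ≤ p * D ^ 2)
  | .unit v => decide (v ⬝ᵥ (X *ᵥ v) = 1)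
  | .iso U V => decide (U * V = 1 ∧ U * X * Uᵀ ∈ L)

/-- A class of extensions, with the certificates for the successive values of the new norm. -/
structure Fam (n : ℕ) where
  r : Fin n → ℤ
  s : ℤ
  certs : List (Cert (n+1))

structure Entry (n : ℕ) where
  X : Matrix (Fin n) (Fin n) ℤ
  A : Matrix (Fin n) (Fin n) ℤ
  d : ℤ
  fam : List (Fam n)

def Fam.ok {n : ℕ} (p q : ℤ) (L : List (Matrix (Fin (n+1)) (Fin (n+1)) ℤ))
    (X A : Matrix (Fin n) (Fin n) ℤ) (d : ℤ) (f : Fam n) : Bool :=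
  decide (d * (f.s - 1) ≤ f.r ⬝ᵥ (A *ᵥ f.r) ∧
    q * d ≤ p * (d * (f.s + f.certs.length) - f.r ⬝ᵥ (A *ᵥ f.r)) ∧
    ∀ j : Fin f.certs.length, (f.certs.get j).ok p q L (blk (f.s + (j : ℕ)) f.r f.r X) = true)

/-- `v` is in the column lattice of `X`. -/
def inImg {n : ℕ} (A : Matrix (Fin n) (Fin n) ℤ) (d : ℤ) (v : Fin n → ℤ) : Bool :=
  decide (∀ i, (A *ᵥ v) i % d = 0)

theorem inImg_sound {n : ℕ} {X A : Matrix (Fin n) (Fin n) ℤ} {d : ℤ} (hd : 0 < d)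
    (hA : X * A = d • 1) {v : Fin n → ℤ} (h : inImg A d v = true) :
    X *ᵥ (fun i => (A *ᵥ v) i / d) = v := by
  have h' := of_decide_eq_true h
  have h1 : d • (fun i => (A *ᵥ v) i / d) = A *ᵥ v := by
    ext i
    simp only [Pi.smul_apply, smul_eq_mul]
    exact Int.mul_ediv_cancel' (Int.dvd_of_emod_eq_zero (h' i))
  have h2 : d • (X *ᵥ (fun i => (A *ᵥ v) i / d)) = d • v := by
    rw [← mulVec_smul, h1, mulVec_mulVec, hA, smul_mulVec, one_mulVec]
  exact smul_right_injective _ hd.ne' h2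

def Entry.ok {n : ℕ} (p q : ℤ) (L : List (Matrix (Fin (n+1)) (Fin (n+1)) ℤ)) (e : Entry n) : Bool :=
  decide (0 < e.d ∧ e.X * e.A = e.d • 1 ∧ (∀ f ∈ e.fam, f.ok p q L e.X e.A e.d = true) ∧
    (∃ f ∈ e.fam, f.r = 0) ∧
    ∀ f ∈ e.fam, ∀ i, ∀ σ ∈ [(1 : ℤ), -1], ∃ f' ∈ e.fam, ∃ τ ∈ [(1 : ℤ), -1],
      inImg e.A e.d (f.r + Pi.single i σ - τ • f'.r) = true)

section
variable {n : ℕ}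

theorem cast_ne {y : Fin n → ℤ} (hy : y ≠ 0) : (fun i => (y i : ℚ)) ≠ 0 := by
  intro h; apply hy; ext i; simpa using congrFun h i

theorem Cert.sound {p q : ℤ} (hq : 0 < q) {L : List (Matrix (Fin n) (Fin n) ℤ)}
    {X : Matrix (Fin n) (Fin n) ℤ} (C : Cert n) (h : C.ok p q L X = true)
    (hG : Good ((p : ℚ) / q) X) : ∃ Y ∈ L, Eqv X Y := by
  cases C with
  | short D y =>
    exfalso
    obtain ⟨hD, hy, hdiv, hle⟩ := of_decide_eq_true h
    have hDq : (0 : ℚ) < D := by exact_mod_cast hD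
    have hqq : (0 : ℚ) < q := by exact_mod_cast hq
    have := hG.1 ((D : ℚ)⁻¹ • (fun i => (y i : ℚ))) (smul_ne_zero (inv_ne_zero hDq.ne') (cast_ne hy))
      ⟨fun i => (X *ᵥ y) i / D, by
        rw [mulVec_smul, qm_mulVec]
        ext i
        obtain ⟨k, hk⟩ := Int.dvd_of_emod_eq_zero (hdiv i)
        simp [hk, hD.ne']⟩
    rw [nrm_smul, nrm_cast] at this
    have hle' : (q : ℚ) * (y ⬝ᵥ (X *ᵥ y) : ℤ) ≤ p * D ^ 2 := by exact_mod_cast hle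
    rw [div_lt_iff₀ hqq] at this
    have h2 : (D : ℚ)⁻¹ ^ 2 * (y ⬝ᵥ (X *ᵥ y) : ℤ) * q = (q * (y ⬝ᵥ (X *ᵥ y) : ℤ)) / D ^ 2 := by
      field_simp
    rw [h2, lt_div_iff₀ (by positivity)] at this
    linarith
  | unit v => exact absurd (of_decide_eq_true h) (hG.2 v)
  | iso U V =>
    obtain ⟨h1, h2⟩ := of_decide_eq_true h
    exact ⟨_, h2, U, V, h1, rfl⟩

theorem int_vec_induction {P : (Fin n → ℤ) → Prop} (h0 : P 0)
    (h : ∀ b, P b → ∀ i, ∀ σ ∈ [(1 : ℤ), -1], P (b + Pi.single i σ)) (b : Fin n → ℤ) : P b := by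
  have h1 : ∀ i (k : ℤ) b, P b → P (b + Pi.single i k) := by
    intro i k
    induction k using Int.induction_on with
    | zero => intro b hb; simpa using hb
    | succ k ih =>
      intro b hb
      have := h _ (ih b hb) i 1 (by simp)
      rwa [add_assoc, ← Pi.single_add] at this
    | pred k ih =>
      intro b hb
      have := h _ (ih b hb) i (-1) (by simp)
      rwa [add_assoc, ← Pi.single_add] at this
  have h2 : ∀ s : Finset (Fin n), P (∑ i ∈ s, Pi.single i (b i)) := by
    intro s
    induction s using Finset.induction_on with
    | empty => simpa using h0
    | insert a s ha ih =>
      rw [Finset.sum_insert ha, add_comm]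
      exact h1 _ _ _ ih
  have := h2 Finset.univ
  rwa [Finset.univ_sum_single] at this

theorem classify_step {p q : ℤ} (hp : 0 < p) (hq : 0 < q) {T : List (Entry n)}
    {L : List (Matrix (Fin (n+1)) (Fin (n+1)) ℤ)} (hok : ∀ e ∈ T, e.ok p q L = true)
    (ih : ∀ X', PDQ X' → Good (3 / 4 * ((p : ℚ) / q)) X' → ∃ Y ∈ T.map Entry.X, Eqv X' Y)
    (X : Matrix (Fin (n+1)) (Fin (n+1)) ℤ) (hX : PDQ X) (hG : Good ((p : ℚ) / q) X) :
    ∃ Y ∈ L, Eqv X Y := by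
  have hpq : (0 : ℚ) < p := by exact_mod_cast hp
  have hqq : (0 : ℚ) < q := by exact_mod_cast hq
  obtain ⟨s, b, X', hE, hP', hG'⟩ := step (by positivity) hX hG
  obtain ⟨Y, hY, hE'⟩ := ih X' hP' hG'
  obtain ⟨e, he, rfl⟩ := List.mem_map.mp hY
  obtain ⟨hd, hA, hfam, hzero, hcl⟩ := of_decide_eq_true (hok e he)
  have hPe := hP'.eqv hE'
  obtain ⟨U, V, hUV, hU⟩ := hE'
  have hE1 := blk_eqv hP'.1 hUV s b 0
  rw [← hU] at hE1
  replace hE1 := hE.trans hE1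
  generalize s + 0 ⬝ᵥ b + (b + X' *ᵥ 0) ⬝ᵥ 0 = s1 at hE1
  generalize U *ᵥ (b + X' *ᵥ 0) = b1 at hE1
  -- reduce `b1`
  have hred : ∃ f ∈ e.fam, ∃ τ ∈ [(1 : ℤ), -1], ∃ u, b1 = e.X *ᵥ u + τ • f.r := by
    refine int_vec_induction (P := fun b1 => ∃ f ∈ e.fam, ∃ τ ∈ [(1 : ℤ), -1], ∃ u,
      b1 = e.X *ᵥ u + τ • f.r) ?_ ?_ b1
    · obtain ⟨f, hf, hr⟩ := hzero
      exact ⟨f, hf, 1, by simp, 0, by simp [hr]⟩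
    · rintro b ⟨f, hf, τ, hτ, u, rfl⟩ i σ hσ
      have hττ : τ * τ = 1 := by
        simp only [List.mem_cons, List.not_mem_nil, or_false] at hτ
        rcases hτ with rfl | rfl <;> rfl
      have hmul : ∀ a ∈ [(1 : ℤ), -1], τ * a ∈ [(1 : ℤ), -1] := by
        intro a ha
        simp only [List.mem_cons, List.not_mem_nil, or_false] at hτ ha ⊢
        rcases hτ with rfl | rfl <;> rcases ha with rfl | rfl <;> simp
      obtain ⟨f', hf', τ', hτ', him⟩ := hcl f hf i (τ * σ) (hmul σ hσ)
      have him' := inImg_sound hd hA him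
      refine ⟨f', hf', τ * τ', hmul τ' hτ', u + τ • (fun i_1 =>
        (e.A *ᵥ (f.r + Pi.single i (τ * σ) - τ' • f'.r)) i_1 / e.d), ?_⟩
      rw [mulVec_add, mulVec_smul, him']
      have h3 : (Pi.single i σ : Fin n → ℤ) = τ • Pi.single i (τ * σ) := by
        rw [← Pi.single_smul, smul_eq_mul, ← mul_assoc, hττ, one_mul]
      rw [h3, smul_sub, smul_add, smul_smul]
      abel
  obtain ⟨f, hf, τ, hτ, u, rfl⟩ := hred
  have hττ : τ * τ = 1 := by
    simp only [List.mem_cons, List.not_mem_nil, or_false] at hτ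
    rcases hτ with rfl | rfl <;> rfl
  have hE2 := blk_eqv (W := τ • 1) (V := τ • 1) hPe.1 (by
    rw [Matrix.smul_mul, Matrix.one_mul, smul_smul, hττ, one_smul]) s1
    (e.X *ᵥ u + τ • f.r) (-u)
  have e1 : (τ • (1 : Matrix (Fin n) (Fin n) ℤ)) *ᵥ (e.X *ᵥ u + τ • f.r + e.X *ᵥ (-u)) = f.r := by
    rw [mulVec_neg, smul_mulVec, one_mulVec, add_comm, ← add_assoc, neg_add_cancel, zero_add,
      smul_smul, hττ, one_smul]
  have e2 : (τ • (1 : Matrix (Fin n) (Fin n) ℤ)) * e.X * (τ • (1 : Matrix (Fin n) (Fin n) ℤ))ᵀ = e.X := by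
    rw [transpose_smul, transpose_one, Matrix.smul_mul, Matrix.one_mul, Matrix.smul_mul,
      Matrix.mul_smul, Matrix.mul_one, smul_smul, hττ, one_smul]
  rw [e1, e2] at hE2
  replace hE2 := hE1.trans hE2
  generalize s1 + -u ⬝ᵥ (e.X *ᵥ u + τ • f.r) + (e.X *ᵥ u + τ • f.r + e.X *ᵥ (-u)) ⬝ᵥ -u = s2 at hE2
  have hP2 := hX.eqv hE2
  have hG2 := hG.eqv hE2
  obtain ⟨r1, r2⟩ := blk_range hd hA hP2 hG2
  obtain ⟨k1, k2, k3⟩ := of_decide_eq_true (hfam f hf)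
  have r3 : p * (e.d * s2 - f.r ⬝ᵥ (e.A *ᵥ f.r)) < q * e.d := by
    rw [div_mul_eq_mul_div, div_lt_iff₀ hqq] at r2
    have : (p : ℚ) * (e.d * s2 - (f.r ⬝ᵥ (e.A *ᵥ f.r) : ℤ)) < q * e.d := by linarith
    exact_mod_cast this
  have l1 : f.s ≤ s2 := by
    by_contra hlt
    have : s2 ≤ f.s - 1 := by omega
    have := mul_le_mul_of_nonneg_left this hd.le
    omega
  have l2 : s2 < f.s + f.certs.length := by
    by_contra hlt
    push Not at hlt
    have h5 := mul_le_mul_of_nonneg_left hlt hd.le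
    have h6 := mul_le_mul_of_nonneg_left (sub_le_sub_right h5 (f.r ⬝ᵥ (e.A *ᵥ f.r))) hp.le
    linarith
  have k4 := k3 ⟨(s2 - f.s).toNat, by omega⟩
  have hs2 : f.s + (((s2 - f.s).toNat : ℕ) : ℤ) = s2 := by omega
  simp only [hs2] at k4
  obtain ⟨Y, hYL, hYE⟩ := Cert.sound hq _ k4 hG2
  exact ⟨Y, hYL, hE2.trans hYE⟩
end
def T0 : List (Entry 0) := [
  ⟨![], ![], 1, [
    ⟨![], 1, [.unit ![1],
      .iso 1 1,
      .iso 1 1,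
      .iso 1 1]⟩]⟩]

def T1 : List (Entry 1) := [
  ⟨![![2]], ![![1]], 2, [
    ⟨![0], 1, [.unit ![1, 0],
      .iso 1 1,
      .iso 1 1]⟩,
    ⟨![1], 1, [.unit ![1, 0],
      .iso 1 1,
      .iso 1 1]⟩]⟩,
  ⟨![![3]], ![![1]], 3, [
    ⟨![0], 1, [.unit ![1, 0],
      .iso ![![0, 1], ![1, 0]] ![![0, 1], ![1, 0]],
      .iso 1 1]⟩,
    ⟨![1], 1, [.unit ![1, 0],
      .iso ![![-1, 1], ![-1, 0]] ![![0, -1], ![1, -1]],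
      .iso 1 1]⟩]⟩,
  ⟨![![4]], ![![1]], 4, [
    ⟨![0], 1, [.unit ![1, 0],
      .short 4 ![0, 1],
      .short 4 ![0, 1]]⟩,
    ⟨![1], 1, [.unit ![1, 0],
      .short 7 ![-1, 2],
      .short 11 ![-1, 3]]⟩,
    ⟨![2], 2, [.iso ![![1, 0], ![-1, 1]] ![![1, 0], ![1, 1]],
      .iso ![![1, 0], ![1, -1]] ![![1, 0], ![1, -1]],
      .iso 1 1]⟩]⟩]

def T2 : List (Entry 2) := [
  ⟨![![2, 0], ![0, 2]], ![![2, 0], ![0, 2]], 4, [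
    ⟨![0, 0], 1, [.unit ![1, 0, 0],
      .iso 1 1]⟩,
    ⟨![1, 0], 1, [.unit ![1, 0, 0],
      .iso 1 1]⟩,
    ⟨![0, 1], 1, [.unit ![1, 0, 0],
      .iso ![![1, 0, 0], ![0, 0, 1], ![0, 1, 0]] ![![1, 0, 0], ![0, 0, 1], ![0, 1, 0]]]⟩,
    ⟨![1, 1], 2, [.iso 1 1,
      .iso 1 1]⟩]⟩,
  ⟨![![3, 0], ![0, 2]], ![![2, 0], ![0, 3]], 6, [
    ⟨![0, 0], 1, [.unit ![1, 0, 0],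
      .short 3 ![0, 1, 0]]⟩,
    ⟨![1, 0], 1, [.unit ![1, 0, 0],
      .short 5 ![-1, 2, 0]]⟩,
    ⟨![0, 1], 1, [.unit ![1, 0, 0],
      .short 3 ![0, 1, 0]]⟩,
    ⟨![1, 1], 1, [.unit ![1, 0, 0],
      .iso 1 1,
      .short 13 ![-2, 5, 1]]⟩]⟩,
  ⟨![![2, 1], ![1, 2]], ![![2, -1], ![-1, 2]], 3, [
    ⟨![0, 0], 1, [.unit ![1, 0, 0],
      .iso ![![0, 1, 0], ![0, 0, 1], ![1, 0, 0]] ![![0, 0, 1], ![1, 0, 0], ![0, 1, 0]]]⟩,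
    ⟨![1, 0], 1, [.unit ![1, 0, 0],
      .iso ![![1, 0, 0], ![0, 1, 0], ![1, -1, 1]] ![![1, 0, 0], ![0, 1, 0], ![-1, 1, 1]],
      .iso ![![0, 1, 0], ![1, 0, 0], ![0, 0, 1]] ![![0, 1, 0], ![1, 0, 0], ![0, 0, 1]]]⟩]⟩,
  ⟨![![3, 1], ![1, 2]], ![![2, -1], ![-1, 3]], 5, [
    ⟨![0, 0], 1, [.unit ![1, 0, 0],
      .short 5 ![0, 2, -1]]⟩,
    ⟨![1, 0], 1, [.unit ![1, 0, 0],
      .iso ![![-1, 1, 0], ![0, 0, 1], ![-1, 0, 0]] ![![0, 0, -1], ![1, 0, -1], ![0, 1, 0]]]⟩,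
    ⟨![0, 1], 1, [.unit ![1, 0, 0],
      .iso ![![1, 0, 0], ![0, -1, 1], ![1, 0, -1]] ![![1, 0, 0], ![1, -1, -1], ![1, 0, -1]]]⟩]⟩,
  ⟨![![3, 0], ![0, 3]], ![![3, 0], ![0, 3]], 9, [
    ⟨![0, 0], 1, [.unit ![1, 0, 0],
      .short 3 ![0, 0, 1]]⟩,
    ⟨![1, 0], 1, [.unit ![1, 0, 0],
      .short 3 ![0, 0, 1]]⟩,
    ⟨![0, 1], 1, [.unit ![1, 0, 0],
      .short 3 ![0, 1, 0]]⟩,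
    ⟨![1, 1], 1, [.unit ![1, 0, 0],
      .short 12 ![-3, 1, 5],
      .short 21 ![-3, 1, 8]]⟩,
    ⟨![1, -1], 1, [.unit ![1, 0, 0],
      .short 12 ![3, -1, 5],
      .short 21 ![3, -1, 8]]⟩]⟩,
  ⟨![![3, 1], ![1, 3]], ![![3, -1], ![-1, 3]], 8, [
    ⟨![0, 0], 1, [.unit ![1, 0, 0],
      .short 8 ![0, -1, 3]]⟩,
    ⟨![1, 0], 1, [.unit ![1, 0, 0],
      .short 13 ![1, -2, 5]]⟩,
    ⟨![0, 1], 1, [.unit ![1, 0, 0],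
      .short 13 ![1, 5, -2]]⟩,
    ⟨![2, 0], 2, [.unit ![-1, 1, 0],
      .short 12 ![2, 3, -1]]⟩,
    ⟨![1, -1], 2, [.iso ![![-1, 1, 0], ![-1, 0, 0], ![-1, 1, -1]] ![![0, -1, 0], ![1, -1, 0], ![1, 0, -1]],
      .iso 1 1]⟩]⟩,
  ⟨![![4, 2], ![2, 4]], ![![4, -2], ![-2, 4]], 12, [
    ⟨![0, 0], 1, [.unit ![1, 0, 0],
      .short 6 ![0, 1, 1]]⟩,
    ⟨![1, 0], 1, [.unit ![1, 0, 0],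
      .short 5 ![-1, 2, -1]]⟩,
    ⟨![0, 1], 1, [.unit ![1, 0, 0],
      .short 5 ![-1, -1, 2]]⟩,
    ⟨![2, 0], 2, [.iso ![![1, 0, 0], ![-1, 1, 0], ![1, -1, 1]] ![![1, 0, 0], ![1, 1, 0], ![0, 1, 1]],
      .short 10 ![2, 2, -1]]⟩,
    ⟨![1, 1], 1, [.unit ![1, 0, 0],
      .short 5 ![-1, 1, 1]]⟩,
    ⟨![1, -1], 2, [.short 6 ![0, 1, 1],
      .short 6 ![0, 1, 1]]⟩,
    ⟨![2, 1], 2, [.short 6 ![0, -1, 2],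
      .short 6 ![0, -1, 2]]⟩,
    ⟨![1, 2], 2, [.short 6 ![0, 2, -1],
      .short 6 ![0, 2, -1]]⟩]⟩]

def T3 : List (Entry 3) := [
  ⟨![![2, 0, 0], ![0, 2, 0], ![0, 0, 2]], ![![4, 0, 0], ![0, 4, 0], ![0, 0, 4]], 8, [
    ⟨![0, 0, 0], 1, [.unit ![1, 0, 0, 0]]⟩,
    ⟨![1, 0, 0], 1, [.unit ![1, 0, 0, 0],
      .short 2 ![0, 0, 0, 1]]⟩,
    ⟨![0, 1, 0], 1, [.unit ![1, 0, 0, 0],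
      .short 2 ![0, 0, 0, 1]]⟩,
    ⟨![0, 0, 1], 1, [.unit ![1, 0, 0, 0],
      .short 2 ![0, 0, 1, 0]]⟩,
    ⟨![1, 1, 0], 2, [.short 2 ![0, 0, 0, 1]]⟩,
    ⟨![1, 0, 1], 2, [.short 2 ![0, 0, 1, 0]]⟩,
    ⟨![0, 1, 1], 2, [.short 2 ![0, 1, 0, 0]]⟩,
    ⟨![1, 1, 1], 2, [.iso 1 1,
      .iso 1 1]⟩]⟩,
  ⟨![![2, 1, 0], ![1, 2, 0], ![0, 0, 2]], ![![4, -2, 0], ![-2, 4, 0], ![0, 0, 3]], 6, [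
    ⟨![0, 0, 0], 1, [.unit ![1, 0, 0, 0]]⟩,
    ⟨![1, 0, 0], 1, [.unit ![1, 0, 0, 0],
      .short 2 ![0, 0, 0, 1]]⟩,
    ⟨![0, 0, 1], 1, [.unit ![1, 0, 0, 0],
      .iso 1 1]⟩,
    ⟨![1, 0, 1], 2, [.iso 1 1]⟩]⟩,
  ⟨![![2, 1, 1], ![1, 2, 0], ![1, 0, 2]], ![![4, -2, -2], ![-2, 3, 1], ![-2, 1, 3]], 4, [
    ⟨![0, 0, 0], 1, [.unit ![1, 0, 0, 0]]⟩,
    ⟨![1, 0, 0], 2, [.iso ![![1, 0, 0, 0], ![0, 1, 0, 0], ![1, -1, 1, 0], ![1, -1, 0, 1]] ![![1, 0, 0, 0], ![0, 1, 0, 0], ![-1, 1, 1, 0], ![-1, 1, 0, 1]]]⟩,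
    ⟨![0, 1, 0], 1, [.unit ![1, 0, 0, 0],
      .iso ![![1, 0, 0, 0], ![0, -1, 1, 0], ![0, -1, 0, 0], ![1, 1, -1, -1]] ![![1, 0, 0, 0], ![0, 0, -1, 0], ![0, 1, -1, 0], ![1, -1, 0, -1]]]⟩]⟩,
  ⟨![![3, 1, 1], ![1, 2, 0], ![1, 0, 2]], ![![4, -2, -2], ![-2, 5, 1], ![-2, 1, 5]], 8, [
    ⟨![0, 0, 0], 1, [.unit ![1, 0, 0, 0]]⟩,
    ⟨![1, 0, 0], 1, [.unit ![1, 0, 0, 0],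
      .iso ![![-1, 1, 0, 0], ![0, 0, 1, 0], ![0, 0, 0, 1], ![-1, 0, 0, 0]] ![![0, 0, 0, -1], ![1, 0, 0, -1], ![0, 1, 0, 0], ![0, 0, 1, 0]]]⟩,
    ⟨![0, 1, 0], 1, [.unit ![1, 0, 0, 0],
      .short 11 ![2, 6, -4, -3]]⟩,
    ⟨![0, 0, 1], 1, [.unit ![1, 0, 0, 0],
      .short 11 ![2, 6, -3, -4]]⟩,
    ⟨![2, 0, 0], 3, [.short 4 ![0, 2, -1, -1]]⟩]⟩,
  ⟨![![2, 1, 1], ![1, 3, 0], ![1, 0, 2]], ![![6, -2, -3], ![-2, 3, 1], ![-3, 1, 5]], 7, [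
    ⟨![0, 0, 0], 1, [.unit ![1, 0, 0, 0]]⟩,
    ⟨![1, 0, 0], 1, [.unit ![1, 0, 0, 0],
      .short 4 ![1, -2, 2, 1]]⟩,
    ⟨![0, 1, 0], 1, [.unit ![1, 0, 0, 0],
      .short 11 ![-3, -4, 6, 2]]⟩,
    ⟨![0, 0, 1], 1, [.unit ![1, 0, 0, 0],
      .short 9 ![-1, -3, 4, 2]]⟩]⟩,
  ⟨![![3, 1, -1], ![1, 3, 1], ![-1, 1, 3]], ![![8, -4, 4], ![-4, 8, -4], ![4, -4, 8]], 16, [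
    ⟨![0, 0, 0], 1, [.unit ![1, 0, 0, 0]]⟩,
    ⟨![1, 0, 0], 1, [.unit ![1, 0, 0, 0],
      .short 4 ![0, 0, 1, 1]]⟩,
    ⟨![0, 1, 0], 1, [.unit ![1, 0, 0, 0],
      .short 4 ![0, -1, 0, 1]]⟩,
    ⟨![0, 0, 1], 1, [.unit ![1, 0, 0, 0],
      .short 4 ![0, 1, 1, 0]]⟩,
    ⟨![2, 0, 0], 3, [.short 4 ![0, 0, 1, 1]]⟩,
    ⟨![1, 1, 0], 1, [.unit ![1, 0, 0, 0],
      .short 4 ![0, 1, -1, 2]]⟩,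
    ⟨![1, 0, -1], 1, [.unit ![1, 0, 0, 0],
      .short 4 ![0, -1, 2, -1]]⟩,
    ⟨![0, 2, 0], 3, [.short 4 ![0, -1, 0, 1]]⟩,
    ⟨![0, 1, 1], 1, [.unit ![1, 0, 0, 0],
      .short 4 ![0, 2, -1, 1]]⟩,
    ⟨![0, 0, 2], 3, [.short 4 ![0, 1, 1, 0]]⟩]⟩]

def T4 : List (Entry 4) := [
  ⟨![![2, 1, 1, 1], ![1, 2, 0, 0], ![1, 0, 2, 0], ![1, 0, 0, 2]], ![![8, -4, -4, -4], ![-4, 4, 2, 2], ![-4, 2, 4, 2], ![-4, 2, 2, 4]], 4, [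
    ⟨![0, 0, 0, 0], 1, [.unit ![1, 0, 0, 0, 0]]⟩,
    ⟨![0, 1, 0, 0], 2, [.iso 1 1]⟩,
    ⟨![0, 0, 1, 0], 2, [.iso ![![1, 0, 0, 0, 0], ![0, 1, 0, 0, 0], ![0, 0, 0, 1, 0], ![0, 0, 1, 0, 0], ![0, 0, 0, 0, 1]] ![![1, 0, 0, 0, 0], ![0, 1, 0, 0, 0], ![0, 0, 0, 1, 0], ![0, 0, 1, 0, 0], ![0, 0, 0, 0, 1]]]⟩,
    ⟨![0, 0, 0, 1], 2, [.iso ![![1, 0, 0, 0, 0], ![0, 1, 0, 0, 0], ![0, 0, 0, 0, 1], ![0, 0, 1, 0, 0], ![0, 0, 0, 1, 0]] ![![1, 0, 0, 0, 0], ![0, 1, 0, 0, 0], ![0, 0, 0, 1, 0], ![0, 0, 0, 0, 1], ![0, 0, 1, 0, 0]]]⟩]⟩,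
  ⟨![![3, 1, 1, 1], ![1, 2, 0, 0], ![1, 0, 2, 0], ![1, 0, 0, 2]], ![![8, -4, -4, -4], ![-4, 8, 2, 2], ![-4, 2, 8, 2], ![-4, 2, 2, 8]], 12, [
    ⟨![0, 0, 0, 0], 1, [.unit ![1, 0, 0, 0, 0]]⟩,
    ⟨![1, 0, 0, 0], 1, [.unit ![1, 0, 0, 0, 0]]⟩,
    ⟨![0, 1, 0, 0], 1, [.unit ![1, 0, 0, 0, 0]]⟩,
    ⟨![0, 0, 1, 0], 1, [.unit ![1, 0, 0, 0, 0]]⟩,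
    ⟨![0, 0, 0, 1], 1, [.unit ![1, 0, 0, 0, 0]]⟩,
    ⟨![1, 0, 0, -1], 3, [.short 3 ![0, 2, -1, -1, -1]]⟩,
    ⟨![1, 0, -1, 0], 3, [.short 3 ![0, 2, -1, -1, -1]]⟩,
    ⟨![1, -1, 0, 0], 3, [.short 3 ![0, 2, -1, -1, -1]]⟩]⟩,
  ⟨![![2, 0, 0, 1], ![0, 2, 1, 0], ![0, 1, 2, 0], ![1, 0, 0, 2]], ![![6, 0, 0, -3], ![0, 6, -3, 0], ![0, -3, 6, 0], ![-3, 0, 0, 6]], 9, [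
    ⟨![0, 0, 0, 0], 1, [.unit ![1, 0, 0, 0, 0]]⟩,
    ⟨![1, 0, 0, 0], 1, [.unit ![1, 0, 0, 0, 0]]⟩,
    ⟨![0, 1, 0, 0], 1, [.unit ![1, 0, 0, 0, 0]]⟩,
    ⟨![1, 1, 0, 0], 2, [.iso 1 1]⟩,
    ⟨![1, 0, -1, 0], 2, [.iso ![![1, 0, 0, 0, 0], ![0, 1, 0, 0, 0], ![1, -1, 0, 0, 1], ![1, -1, -1, 1, 1], ![-1, 1, 0, -1, 0]] ![![1, 0, 0, 0, 0], ![0, 1, 0, 0, 0], ![-1, 1, 1, -1, -1], ![-1, 1, 0, 0, -1], ![-1, 1, 1, 0, 0]]]⟩]⟩,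
  ⟨![![2, 1, 0, 1], ![1, 2, 1, 0], ![0, 1, 2, 0], ![1, 0, 0, 2]], ![![6, -4, 2, -3], ![-4, 6, -3, 2], ![2, -3, 4, -1], ![-3, 2, -1, 4]], 5, [
    ⟨![0, 0, 0, 0], 1, [.unit ![1, 0, 0, 0, 0]]⟩,
    ⟨![1, 0, 0, 0], 2, [.iso ![![1, 0, 0, 0, 0], ![0, 0, 1, 0, 0], ![0, 1, 0, 0, 0], ![0, 0, 0, 1, 0], ![1, -2, 2, -1, 1]] ![![1, 0, 0, 0, 0], ![0, 0, 1, 0, 0], ![0, 1, 0, 0, 0], ![0, 0, 0, 1, 0], ![-1, -2, 2, 1, 1]]]⟩,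
    ⟨![0, 0, 1, 0], 1, [.unit ![1, 0, 0, 0, 0],
      .iso ![![1, 0, 0, 0, 0], ![0, 0, -1, 1, 0], ![1, -1, 1, -1, 1], ![0, 0, 0, 0, 1], ![0, 0, -1, 0, 0]] ![![1, 0, 0, 0, 0], ![1, -1, -1, 1, 0], ![0, 0, 0, 0, -1], ![0, 1, 0, 0, -1], ![0, 0, 0, 1, 0]]]⟩]⟩]

def T5 : List (Entry 5) := [
  ⟨![![2, 0, 1, 0, 0], ![0, 2, 1, 1, 1], ![1, 1, 2, 0, 0], ![0, 1, 0, 2, 0], ![0, 1, 0, 0, 2]], ![![4, 4, -4, -2, -2], ![4, 12, -8, -6, -6], ![-4, -8, 8, 4, 4], ![-2, -6, 4, 5, 3], ![-2, -6, 4, 3, 5]], 4, [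
    ⟨![0, 0, 0, 0, 0], 1, []⟩,
    ⟨![1, 0, 0, 0, 0], 2, []⟩,
    ⟨![0, 0, 0, 1, 0], 2, [.iso ![![1, 0, 0, 0, 0, 0], ![0, 1, 0, 0, 0, 0], ![0, 0, -1, 0, 1, 0], ![0, 0, -1, 1, 1, 0], ![0, 0, -2, 1, 1, 1], ![1, 1, 1, -1, -1, -1]] ![![1, 0, 0, 0, 0, 0], ![0, 1, 0, 0, 0, 0], ![1, 1, 0, 0, -1, -1], ![0, 0, -1, 1, 0, 0], ![1, 1, 1, 0, -1, -1], ![1, 1, 0, -1, 0, -1]]]⟩]⟩,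
  ⟨![![2, 1, 1, 0, 0], ![1, 2, 0, 0, 1], ![1, 0, 2, 1, 0], ![0, 0, 1, 2, 0], ![0, 1, 0, 0, 2]], ![![9, -6, -6, 3, 3], ![-6, 8, 4, -2, -4], ![-6, 4, 8, -4, -2], ![3, -2, -4, 5, 1], ![3, -4, -2, 1, 5]], 6, [
    ⟨![0, 0, 0, 0, 0], 1, []⟩,
    ⟨![1, 0, 0, 0, 0], 2, [.iso ![![1, 0, 0, 0, 0, 0], ![0, 0, 1, 0, 0, 0], ![0, 1, -1, -1, 0, 1], ![1, -1, 1, 0, 0, 0], ![0, 1, 0, -1, 0, 0], ![1, -1, 1, 1, -1, 0]] ![![1, 0, 0, 0, 0, 0], ![1, 1, 0, -1, 0, 0], ![0, 1, 0, 0, 0, 0], ![1, 1, 0, -1, -1, 0], ![1, 1, 0, 0, -1, -1], ![0, 1, 1, 0, -1, 0]]]⟩,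
    ⟨![0, 1, 0, 0, 0], 2, [.short 2 ![-1, 0, 0, 0, 0, 1]]⟩,
    ⟨![0, 0, 0, 1, 0], 1, [.unit ![1, 0, 0, 0, 0, 0]]⟩]⟩]
def R1 : List (Cert 1) := [.short 2 ![1], .short 3 ![1], .short 2 ![1]]

def R2 : List (Cert 2) := [.short 2 ![0, 1], .short 2 ![0, 1], .short 3 ![1, 1], .short 5 ![2, -1], .short 3 ![0, 1], .short 2 ![-1, 1], .short 2 ![0, 1]]

def R3 : List (Cert 3) := [.short 2 ![0, 0, 1], .short 2 ![0, 0, 1], .short 2 ![0, -1, 1], .short 2 ![0, -1, 1], .short 7 ![-2, 3, 1], .short 2 ![0, -1, 1]]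

def R4 : List (Cert 4) := [.short 2 ![0, -1, 0, 1], .short 2 ![0, -1, 0, 1], .short 3 ![0, 1, 1, 0], .short 5 ![2, 2, -1, -1]]

def R5 : List (Cert 5) := [.short 2 ![0, 0, 0, -1, 1], .short 6 ![3, -2, 2, -1, 1]]

theorem T0_ok : ∀ e ∈ T0, e.ok 243 1024 (T1.map Entry.X) = true := by decide +kernel
theorem T1_ok : ∀ e ∈ T1, e.ok 81 256 (T2.map Entry.X) = true := by decide +kernel
theorem T2_ok : ∀ e ∈ T2, e.ok 27 64 (T3.map Entry.X) = true := by decide +kernel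
theorem T3_ok : ∀ e ∈ T3, e.ok 9 16 (T4.map Entry.X) = true := by decide +kernel
theorem T4_ok : ∀ e ∈ T4, e.ok 3 4 (T5.map Entry.X) = true := by decide +kernel
theorem T5_ok : ∀ e ∈ T5, e.ok 1 1 [mordellM] = true := by decide +kernel

def Red {n : ℕ} (X : Matrix (Fin n) (Fin n) ℤ) : Prop :=
  ∃ x : Fin n → ℤ, x ≠ 0 ∧ PSDQ (X - vecMulVec x x)

section final
variable {n : ℕ}

theorem vmv_sym (x : Fin n → ℤ) : (vecMulVec x x)ᵀ = vecMulVec x x := by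
  ext i j; simp [vecMulVec, mul_comm]

theorem nrm_sub_vmv (X : Matrix (Fin n) (Fin n) ℤ) (x : Fin n → ℤ) (y : Fin n → ℚ) :
    nrm (X - vecMulVec x x) y = nrm X y - (y ⬝ᵥ (fun i => (x i : ℚ))) ^ 2 := by
  have h : qm (X - vecMulVec x x) = qm X - vecMulVec (fun i => (x i : ℚ)) (fun i => (x i : ℚ)) := by
    ext i j; simp [qm, vecMulVec]
  rw [nrm, nrm, h, sub_mulVec, dotProduct_sub, vecMulVec_mulVec, dotProduct_smul]
  rw [dotProduct_comm (fun i => (x i : ℚ)) y]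
  simp [sq]

theorem Red.eqv {X Y : Matrix (Fin n) (Fin n) ℤ} (hX : Red X) (h : Eqv X Y) : Red Y := by
  obtain ⟨U, V, h1, rfl⟩ := h
  obtain ⟨x, hx, hP⟩ := hX
  have h2 : V * U = 1 := mul_eq_one_comm.mp h1
  refine ⟨U *ᵥ x, ?_, ?_⟩
  · intro h0
    apply hx
    rw [← one_mulVec x, ← h2, ← mulVec_mulVec, h0, mulVec_zero]
  · have h3 : U * (X - vecMulVec x x) * Uᵀ = U * X * Uᵀ - vecMulVec (U *ᵥ x) (U *ᵥ x) := by
      rw [Matrix.mul_sub, Matrix.sub_mul, mul_vecMulVec, vecMulVec_mul, vecMul_transpose]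
    rw [← h3]
    exact hP.eqv ⟨U, V, h1, rfl⟩

theorem red_of_short {X : Matrix (Fin n) (Fin n) ℤ} (hX : PDQ X) {y : Fin n → ℚ} (hy : y ≠ 0)
    (hd : IsDual X y) (h1 : nrm X y ≤ 1) : Red X := by
  obtain ⟨x, hx⟩ := hd
  have hpos := hX.2 y hy
  refine ⟨x, ?_, ?_, ?_⟩
  · rintro rfl
    rw [nrm, hx] at hpos
    simp at hpos
  · rw [transpose_sub, vmv_sym, hX.1]
  · intro v
    rw [nrm_sub_vmv, ← hx]
    have hnn : ∀ w, 0 ≤ nrm X w := by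
      intro w
      by_cases hw : w = 0
      · simp [hw, nrm]
      · exact (hX.2 w hw).le
    have h2 := hnn (nrm X y • v + (-(v ⬝ᵥ (qm X *ᵥ y))) • y)
    rw [nrm_add hX.1, nrm_smul, nrm_smul, mulVec_smul, dotProduct_smul, smul_dotProduct,
      smul_eq_mul, smul_eq_mul] at h2
    generalize v ⬝ᵥ (qm X *ᵥ y) = t at *
    have h3 : 0 ≤ nrm X y * (nrm X y * nrm X v - t ^ 2) := by nlinarith
    have h4 := nonneg_of_mul_nonneg_right h3 hpos
    nlinarith [hnn v]

theorem good_of_not_red {X : Matrix (Fin n) (Fin n) ℤ} (hX : PDQ X) (h : ¬ Red X) : Good 1 X := by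
  refine ⟨fun y hy hd => ?_, fun v hv => ?_⟩
  · by_contra hlt
    exact h (red_of_short hX hy hd (not_lt.mp hlt))
  · have hv0 : v ≠ 0 := by rintro rfl; simp at hv
    refine h (red_of_short hX (cast_ne hv0) ⟨_, qm_mulVec X v⟩ ?_)
    rw [nrm_cast, hv]; simp

theorem psd_null {X : Matrix (Fin n) (Fin n) ℤ} (hX : PSDQ X) {y : Fin n → ℚ} (h0 : nrm X y = 0) :
    qm X *ᵥ y = 0 := by
  by_contra hne
  have hw : 0 < (qm X *ᵥ y) ⬝ᵥ (qm X *ᵥ y) := by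
    have h1 : 0 ≤ (qm X *ᵥ y) ⬝ᵥ (qm X *ᵥ y) := Finset.sum_nonneg fun i _ => mul_self_nonneg _
    refine lt_of_le_of_ne h1 fun h => hne (dotProduct_self_eq_zero.mp h.symm)
  set w := qm X *ᵥ y with hwd
  have h2 := hX.2 (w + (-((nrm X w + 1) / (w ⬝ᵥ w))) • y)
  rw [nrm_add hX.1, nrm_smul, h0, mulVec_smul, dotProduct_smul, ← hwd, smul_eq_mul, neg_mul,
    div_mul_cancel₀ _ hw.ne'] at h2
  have := hX.2 w
  linarith

theorem singular_step (ih : ∀ X : Matrix (Fin n) (Fin n) ℤ, PSDQ X → X = 0 ∨ Red X)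
    (X : Matrix (Fin (n+1)) (Fin (n+1)) ℤ) (hX : PSDQ X) (hn : ¬ PDQ X) : X = 0 ∨ Red X := by
  obtain ⟨y, hy, h0⟩ : ∃ y, y ≠ 0 ∧ nrm X y = 0 := by
    by_contra! hc
    exact hn ⟨hX.1, fun y hy => lt_of_le_of_ne (hX.2 y) (Ne.symm (hc y hy))⟩
  have hdet : (qm X).det = 0 := exists_mulVec_eq_zero_iff.mp ⟨y, hy, psd_null hX h0⟩
  have hdet' : X.det = 0 := by
    have h1 : (qm X).det = ((X.det : ℤ) : ℚ) := by
      rw [qm]; exact (Int.cast_det X).symm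
    rw [hdet] at h1
    exact_mod_cast h1.symm
  obtain ⟨v, hv, hXv⟩ := exists_mulVec_eq_zero_iff.mpr hdet'
  obtain ⟨U, V, g, hUV, hg⟩ := exists_reduce v
  have hVU : V * U = 1 := mul_eq_one_comm.mp hUV
  have hE : Eqv X (Vᵀ * X * Vᵀᵀ) := ⟨Vᵀ, Uᵀ, by rw [← transpose_mul, hUV, transpose_one], rfl⟩
  have hY0 : (Vᵀ * X * Vᵀᵀ) *ᵥ (Pi.single 0 g) = 0 := by
    rw [← hg, transpose_transpose, mulVec_mulVec, Matrix.mul_assoc, hVU, Matrix.mul_one,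
      ← mulVec_mulVec, hXv, mulVec_zero]
  have hg0 : g ≠ 0 := by
    rintro rfl
    apply hv
    rw [← one_mulVec v, ← hVU, ← mulVec_mulVec, hg]; simp
  have hPY := hX.eqv hE
  generalize Vᵀ * X * Vᵀᵀ = Y at *
  obtain ⟨s, b, b', X', rfl⟩ : ∃ s b b' X', Y = blk s b b' X' := ⟨_, _, _, _, blk_eta Y⟩
  obtain ⟨rfl, hs⟩ := blk_sym hPY.1
  have hsg : (Pi.single 0 g : Fin (n+1) → ℤ) = Fin.cons g 0 := by
    ext i; refine Fin.cases ?_ (fun i => ?_) i <;> simp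
  rw [hsg, blk_mulVec] at hY0
  have hs0 : s = 0 := by
    have := congrFun hY0 0
    simpa [hg0] using this
  have hb0 : b' = 0 := by
    ext i
    have := congrFun hY0 i.succ
    simpa [hg0] using this
  subst hs0 hb0
  have hP' : PSDQ X' := ⟨hs, fun y => by rw [← nrm_cons0 0 0 0]; exact hPY.2 _⟩
  rcases ih X' hP' with rfl | ⟨x, hx, hPx⟩
  · left
    obtain ⟨U', V', -, rfl⟩ := hE.symm
    have : blk (0 : ℤ) 0 0 (0 : Matrix (Fin n) (Fin n) ℤ) = 0 := by
      ext i j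
      refine Fin.cases ?_ (fun i => ?_) i <;> refine Fin.cases ?_ (fun j => ?_) j <;> simp [blk]
    rw [this]; simp
  · right
    refine Red.eqv ?_ hE.symm
    refine ⟨Fin.cons 0 x, ?_, ?_⟩
    · intro h; apply hx; ext i; simpa using congrFun h i.succ
    · have : blk 0 0 0 X' - vecMulVec (Fin.cons 0 x : Fin (n+1) → ℤ) (Fin.cons 0 x) =
          blk 0 0 0 (X' - vecMulVec x x) := by
        ext i j
        refine Fin.cases ?_ (fun i => ?_) i <;> refine Fin.cases ?_ (fun j => ?_) j <;>
          simp [blk, vecMulVec]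
      rw [this]
      refine ⟨?_, fun y => ?_⟩
      · rw [blk_transpose, hPx.1]
      · rw [← Fin.cons_self_tail y, nrm, qm_blk, blk_mulVec, cons_dot]
        have := hPx.2 (Fin.tail y)
        rw [nrm] at this
        have hz : (fun _ : Fin n => (0 : ℚ)) = 0 := rfl
        simpa [hz] using this

theorem pd_step {c : ℚ} (hc : c ≤ 1) {L : List (Matrix (Fin n) (Fin n) ℤ)} {R : List (Cert n)}
    (hR : ∀ Y ∈ L, ∃ C ∈ R, C.ok 1 1 [] Y = true)
    (hcls : ∀ X, PDQ X → Good c X → ∃ Y ∈ L, Eqv X Y)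
    (X : Matrix (Fin n) (Fin n) ℤ) (hX : PDQ X) : Red X := by
  by_contra hr
  have hG := good_of_not_red hX hr
  obtain ⟨Y, hY, hE⟩ := hcls X hX (hG.mono hc)
  obtain ⟨C, -, hC⟩ := hR Y hY
  obtain ⟨Z, hZ, -⟩ := Cert.sound (by norm_num) C hC (by simpa using hG.eqv hE)
  simp at hZ

theorem full_step {c : ℚ} (hc : c ≤ 1) {L : List (Matrix (Fin (n+1)) (Fin (n+1)) ℤ)}
    {R : List (Cert (n+1))} (hR : ∀ Y ∈ L, ∃ C ∈ R, C.ok 1 1 [] Y = true)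
    (hcls : ∀ X, PDQ X → Good c X → ∃ Y ∈ L, Eqv X Y)
    (ih : ∀ X : Matrix (Fin n) (Fin n) ℤ, PSDQ X → X = 0 ∨ Red X)
    (X : Matrix (Fin (n+1)) (Fin (n+1)) ℤ) (hX : PSDQ X) : X = 0 ∨ Red X := by
  by_cases hP : PDQ X
  · exact Or.inr (pd_step hc hR hcls X hP)
  · exact singular_step ih X hX hP
end final

theorem cls1 (X) (hX : PDQ X) (hG : Good (((243 : ℤ) : ℚ) / ((1024 : ℤ) : ℚ)) X) :
    ∃ Y ∈ T1.map Entry.X, Eqv X Y :=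
  classify_step (by norm_num) (by norm_num) T0_ok
    (fun X' _ _ => ⟨_, List.mem_map.mpr ⟨_, List.mem_singleton.mpr rfl, rfl⟩, by
      rw [Subsingleton.elim (Entry.X _) X']; exact Eqv.refl X'⟩) X hX hG

theorem cls2 (X) (hX : PDQ X) (hG : Good (((81 : ℤ) : ℚ) / ((256 : ℤ) : ℚ)) X) :
    ∃ Y ∈ T2.map Entry.X, Eqv X Y :=
  classify_step (by norm_num) (by norm_num) T1_ok
    (fun X' h1 h2 => cls1 X' h1 (h2.mono (by norm_num))) X hX hG

theorem cls3 (X) (hX : PDQ X) (hG : Good (((27 : ℤ) : ℚ) / ((64 : ℤ) : ℚ)) X) :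
    ∃ Y ∈ T3.map Entry.X, Eqv X Y :=
  classify_step (by norm_num) (by norm_num) T2_ok
    (fun X' h1 h2 => cls2 X' h1 (h2.mono (by norm_num))) X hX hG

theorem cls4 (X) (hX : PDQ X) (hG : Good (((9 : ℤ) : ℚ) / ((16 : ℤ) : ℚ)) X) :
    ∃ Y ∈ T4.map Entry.X, Eqv X Y :=
  classify_step (by norm_num) (by norm_num) T3_ok
    (fun X' h1 h2 => cls3 X' h1 (h2.mono (by norm_num))) X hX hG

theorem cls5 (X) (hX : PDQ X) (hG : Good (((3 : ℤ) : ℚ) / ((4 : ℤ) : ℚ)) X) :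
    ∃ Y ∈ T5.map Entry.X, Eqv X Y :=
  classify_step (by norm_num) (by norm_num) T4_ok
    (fun X' h1 h2 => cls4 X' h1 (h2.mono (by norm_num))) X hX hG

theorem cls6 (X) (hX : PDQ X) (hG : Good (((1 : ℤ) : ℚ) / ((1 : ℤ) : ℚ)) X) :
    ∃ Y ∈ [mordellM], Eqv X Y :=
  classify_step (by norm_num) (by norm_num) T5_ok
    (fun X' h1 h2 => cls5 X' h1 (h2.mono (by norm_num))) X hX hG

theorem red5 (X : Matrix (Fin 5) (Fin 5) ℤ) (hX : PSDQ X) : X = 0 ∨ Red X := by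
  have h0 : ∀ X : Matrix (Fin 0) (Fin 0) ℤ, PSDQ X → X = 0 ∨ Red X :=
    fun X _ => Or.inl (Subsingleton.elim _ _)
  have h1 := full_step (R := R1) (by norm_num) (by decide +kernel) cls1 h0
  have h2 := full_step (R := R2) (by norm_num) (by decide +kernel) cls2 h1
  have h3 := full_step (R := R3) (by norm_num) (by decide +kernel) cls3 h2
  have h4 := full_step (R := R4) (by norm_num) (by decide +kernel) cls4 h3
  exact full_step (R := R5) (by norm_num) (by decide +kernel) cls5 h4 X hX

theorem irred6 (X : Matrix (Fin 6) (Fin 6) ℤ) (hX : PSDQ X) :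
    X = 0 ∨ Red X ∨ Eqv mordellM X := by
  by_cases hP : PDQ X
  · right
    by_cases hr : Red X
    · exact Or.inl hr
    · right
      obtain ⟨Y, hY, hE⟩ := cls6 X hP ((good_of_not_red hP hr).mono (by norm_num))
      rw [List.mem_singleton] at hY
      subst hY
      exact hE.symm
  · rcases singular_step red5 X hX hP with h | h
    · exact Or.inl h
    · exact Or.inr (Or.inl h)

theorem psdq_of_real {n : ℕ} {X : Matrix (Fin n) (Fin n) ℤ}
    (hX : (X.map (Int.cast : ℤ → ℝ)).PosSemidef) : PSDQ X := by
  constructor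
  · ext i j
    have := hX.1.apply i j
    simpa using this
  · intro y
    have h := hX.dotProduct_mulVec_nonneg (fun i => (y i : ℝ))
    have h2 : ((nrm X y : ℚ) : ℝ) = star (fun i => (y i : ℝ)) ⬝ᵥ (X.map (Int.cast : ℤ → ℝ) *ᵥ (fun i => (y i : ℝ))) := by
      simp [nrm, qm, dotProduct, mulVec]
    rw [← h2] at h
    exact_mod_cast h

theorem diag_nonneg {n : ℕ} {X : Matrix (Fin n) (Fin n) ℤ} (hX : PSDQ X) (i : Fin n) : 0 ≤ X i i := by
  have := hX.2 (fun j => ((Pi.single i 1 : Fin n → ℤ) j : ℚ))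
  rw [nrm_cast] at this
  simpa using this

theorem decomp (N : ℕ) : ∀ X : Matrix (Fin 6) (Fin 6) ℤ, PSDQ X → X.trace.toNat = N →
    ∃ (k : ℕ) (x : Fin k → Fin 6 → ℤ) (Y : Matrix (Fin 6) (Fin 6) ℤ),
      (Y = 0 ∨ ∃ U : Matrix (Fin 6) (Fin 6) ℤ, IsUnit U.det ∧
        Y = U * mordellM * U.transpose) ∧
      X = (∑ i : Fin k, Matrix.vecMulVec (x i) (x i)) + Y := by
  induction N using Nat.strong_induction_on with
  | _ N ih =>
  intro X hX hN
  rcases irred6 X hX with h | ⟨x, hx, hP⟩ | ⟨U, V, hUV, hE⟩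
  · exact ⟨0, fun i => i.elim0, 0, Or.inl rfl, by simp [h]⟩
  · have ht : X.trace = (X - vecMulVec x x).trace + x ⬝ᵥ x := by
      rw [trace_sub, trace_vecMulVec]; ring
    have h1 : 0 ≤ (X - vecMulVec x x).trace := Finset.sum_nonneg fun i _ => diag_nonneg hP i
    have h2 : 0 < x ⬝ᵥ x := by
      have h3 : 0 ≤ x ⬝ᵥ x := Finset.sum_nonneg fun i _ => mul_self_nonneg _
      exact lt_of_le_of_ne h3 fun h => hx (dotProduct_self_eq_zero.mp h.symm)
    obtain ⟨k, z, Y, hY, hXY⟩ := ih _ (by omega) _ hP rfl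
    refine ⟨k + 1, Fin.cons x z, Y, hY, ?_⟩
    rw [Fin.sum_univ_succ]
    simp only [Fin.cons_zero, Fin.cons_succ]
    rw [add_assoc, ← hXY]; abel
  · refine ⟨0, fun i => i.elim0, X, Or.inr ⟨U, ?_, hE⟩, by simp⟩
    exact IsUnit.of_mul_eq_one V.det (by rw [← det_mul, hUV, det_one])

/-- Every `X ∈ S^6_+(ℤ)` is a sum of integer rank-1 matrices plus a
matrix `Y` that is either zero or unimodularly equivalent to Mordell's matrix `M`. -/
theorem psd_int_six_decomposition_rank_one_plus_mordell
    (X : Matrix (Fin 6) (Fin 6) ℤ)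
    (hX : (X.map (Int.cast : ℤ → ℝ)).PosSemidef) :
    ∃ (k : ℕ) (x : Fin k → Fin 6 → ℤ) (Y : Matrix (Fin 6) (Fin 6) ℤ),
      (Y = 0 ∨ ∃ U : Matrix (Fin 6) (Fin 6) ℤ, IsUnit U.det ∧
        Y = U * mordellM * U.transpose) ∧
      X = (∑ i : Fin k, Matrix.vecMulVec (x i) (x i)) + Y := by
  exact decomp _ X (psdq_of_real hX) rfl
end

section
/- Let 3 ≤ n ≤ 10 and let s ∈ T_n. Then A_n⁺ s ∈ T_n and (A_n⁺)⁻¹ s ∈ T_n. -/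
open Matrix

/-- Membership in `T_N = SOC(N) ∩ ℤ^N` (dimension `N = n+1`). -/
def memT {n : ℕ} (s : Fin (n + 1) → ℤ) : Prop :=
  0 ≤ s (Fin.last n) ∧ (∑ i : Fin n, s i.castSucc ^ 2) ≤ s (Fin.last n) ^ 2

/-- The bilinear form `⟨a,b⟩ = a₁b₁ + ⋯ + a_{N-1}b_{N-1} - a_N b_N`. -/
def socForm {n : ℕ} (a b : Fin (n + 1) → ℤ) : ℤ :=
  (∑ i : Fin n, a i.castSucc * b i.castSucc) - a (Fin.last n) * b (Fin.last n)

/-- A point `s ∈ T_N` is sporadic if no nonzero Pythagorean tuple can be subtracted. -/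
def socSporadic {n : ℕ} (s : Fin (n + 1) → ℤ) : Prop :=
  ¬ ∃ p : Fin (n + 1) → ℤ, p ≠ 0 ∧ memT p ∧ socForm p p = 0 ∧ memT (s - p)

/-- The matrix `A_N` (of Definition 5 of the paper), for dimension `N = n+1`. -/
def Amat (n : ℕ) : Matrix (Fin (n + 1)) (Fin (n + 1)) ℤ :=
  fun i j =>
    if n + 1 = 3 then
      (if (j : ℕ) = 2 then (if (i : ℕ) = 2 then 3 else 2)
       else if (i : ℕ) = (j : ℕ) then -1 else -2)
    else
      (if (i : ℕ) < 3 ∧ (j : ℕ) < 3 then (if i = j then 0 else -1)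
       else if (i : ℕ) < 3 ∧ j = Fin.last n then 1
       else if i = Fin.last n ∧ (j : ℕ) < 3 then -1
       else if i = Fin.last n ∧ j = Fin.last n then 2
       else if i = j then 1 else 0)

/-- The diagonal matrix `Q_k` flipping the sign of the `k`-th coordinate. -/
def Qmat {n : ℕ} (k : Fin n) : Matrix (Fin n) (Fin n) ℤ :=
  Matrix.diagonal fun i => if i = k then -1 else 1

/-- `A_N⁺ = Q₁ Q₂ ⋯ Q_{N-1} A_N`, i.e. the product of `A_N` with the diagonal matrix
flipping the signs of the first `N - 1` coordinates. -/
def AmatPlus (n : ℕ) : Matrix (Fin (n + 1)) (Fin (n + 1)) ℤ :=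
  (Matrix.diagonal fun i : Fin (n + 1) => if i = Fin.last n then 1 else -1) * Amat n

/-- An integer vector is primitive if the gcd of its coordinates is `1`. -/
def primitiveVec {n : ℕ} (s : Fin n → ℤ) : Prop :=
  Finset.univ.gcd s = 1


lemma Amat_sq (n : ℕ) (h3 : 2 ≤ n) (h10 : n ≤ 9) : Amat n * Amat n = 1 := by
  interval_cases n <;> decide +kernel

lemma memT_flip (n : ℕ) (s : Fin (n + 1) → ℤ) (hs : memT s) :
    memT ((Matrix.diagonal fun i : Fin (n + 1) => if i = Fin.last n then (1 : ℤ) else -1).mulVec s) := by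
  have h : ∀ i : Fin n, i.castSucc ≠ Fin.last n := fun i => (Fin.castSucc_lt_last i).ne
  simpa [memT, Matrix.mulVec_diagonal, h] using hs

lemma flip_sq (n : ℕ) :
    (Matrix.diagonal fun i : Fin (n + 1) => if i = Fin.last n then (1 : ℤ) else -1) *
    (Matrix.diagonal fun i : Fin (n + 1) => if i = Fin.last n then (1 : ℤ) else -1) = 1 := by
  rw [Matrix.diagonal_mul_diagonal, ← Matrix.diagonal_one]
  congr 1
  ext i
  split_ifs <;> simp

/-- The last coordinate stays nonnegative. -/
lemma last_nonneg (a b c t : ℤ) (ht : 0 ≤ t)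
    (h : a ^ 2 + b ^ 2 + c ^ 2 ≤ t ^ 2) : a + b + c ≤ 2 * t := by
  refine le_of_abs_le (abs_le_of_sq_le_sq ?_ (by linarith))
  nlinarith [sq_nonneg (a - b), sq_nonneg (a - c), sq_nonneg (b - c), sq_nonneg t]

lemma memT_Amat (n : ℕ) (h3 : 2 ≤ n) (h10 : n ≤ 9) (s : Fin (n + 1) → ℤ) (hs : memT s) :
    memT ((Amat n).mulVec s) := by
  obtain ⟨h0, h1⟩ := hs
  interval_cases n
  · simp only [memT, Matrix.mulVec, dotProduct, Fin.sum_univ_succ, Fin.sum_univ_zero] at *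
    simp [Amat] at *
    refine ⟨?_, by nlinarith⟩
    have := abs_le_of_sq_le_sq (a := 2 * s 0 + 2 * s 1) (b := 3 * s 2)
      (by nlinarith [sq_nonneg (s 0 - s 1), sq_nonneg (s 2)]) (by linarith)
    linarith [le_of_abs_le this]
  all_goals
    simp only [memT, Matrix.mulVec, dotProduct, Fin.sum_univ_succ, Fin.sum_univ_zero] at *
    simp [Amat, Fin.ext_iff] at *
    refine ⟨?_, by nlinarith⟩
    have := last_nonneg (s 0) (s 1) (s 2) _ h0 (le_trans (by
      simp only [← add_assoc]
      repeat' first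
        | exact le_refl _
        | refine le_trans ?_ (le_add_of_nonneg_right (sq_nonneg _))) h1)
    linarith

theorem AmatPlus_mulVec_mem_T_and_inv_mem_T
    (n : ℕ) (h3 : 2 ≤ n) (h10 : n ≤ 9) (s : Fin (n + 1) → ℤ) (hs : memT s) :
    memT ((AmatPlus n).mulVec s) ∧ memT ((AmatPlus n)⁻¹.mulVec s) := by
  have hinv : (AmatPlus n)⁻¹ = Amat n *
      (Matrix.diagonal fun i : Fin (n + 1) => if i = Fin.last n then (1 : ℤ) else -1) := by
    apply Matrix.inv_eq_right_inv
    rw [AmatPlus, Matrix.mul_assoc, ← Matrix.mul_assoc (Amat n), Amat_sq n h3 h10,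
      Matrix.one_mul, flip_sq]
  constructor
  · rw [AmatPlus, ← Matrix.mulVec_mulVec]
    exact memT_flip n _ (memT_Amat n h3 h10 s hs)
  · rw [hinv, ← Matrix.mulVec_mulVec]
    exact memT_Amat n h3 h10 _ (memT_flip n s hs)
end

section
/- Let 3 ≤ n ≤ 10 and let G be the subgroup of GL(n,ℤ) generated by A_n⁺, Q₁, …, Q_{n−1}, P_{1,2}, P_{1,3}, …, P_{1,n−1}. Then g·T_n = T_n for every g ∈ G, and every s ∈ T_n can be written as s = Σ_{i∈K} λ_i g_i r_i for a finite index set K, nonnegative integers λ_i, group elements g_i ∈ G, and roots r_i ∈ R_n, where: for 3 ≤ n ≤ 6, R_n = {(1,0,…,0,1), (0,…,0,1)}; for n = 7, R_n = {(1,0,0,0,0,0,1), (0,0,0,0,0,0,1), (1,1,1,1,1,1,3)}; for n = 8, R_n = {(1,0,0,0,0,0,0,1), (0,0,0,0,0,0,0,1), (1,1,1,1,1,1,1,3), (1,1,1,1,1,1,0,3)}; for n = 9, R_n = {(1,0,0,0,0,0,0,0,1), (0,0,0,0,0,0,0,0,1), (1,1,1,1,1,1,1,1,3), (1,1,1,1,1,1,1,0,3),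 (1,1,1,1,1,1,0,0,3), (2,2,2,2,2,2,2,1,6)}; for n = 10, R_n = {(1,0,0,0,0,0,0,0,0,1), (1,1,1,1,1,1,1,1,1,3), (0,0,0,0,0,0,0,0,0,1), (1,1,1,1,1,1,1,1,0,3), (1,1,1,1,1,1,1,0,0,3), (1,1,1,1,1,1,0,0,0,3), (2,2,2,2,2,2,2,2,1,6), (2,2,2,2,2,2,2,1,0,6)}. -/
open Matrix

/-- The tuple `(1,…,1,0,…,0,3)` with `k` ones followed by zeros and last entry `3`. -/
def onesTup (n k : ℕ) : Fin (n + 1) → ℤ :=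
  fun i => if i = Fin.last n then 3 else if (i : ℕ) < k then 1 else 0

/-- The tuple `(2,…,2,1,0,…,0,6)` with `k` twos, a single one, zeros, last entry `6`. -/
def twosTup (n k : ℕ) : Fin (n + 1) → ℤ :=
  fun i => if i = Fin.last n then 6 else if (i : ℕ) < k then 2
           else if (i : ℕ) = k then 1 else 0

/-- The tuple `(1,0,…,0,1)`. -/
def extTup (n : ℕ) : Fin (n + 1) → ℤ :=
  fun i => if i = 0 ∨ i = Fin.last n then 1 else 0

/-- The tuple `(0,…,0,1)`. -/
def unitTup (n : ℕ) : Fin (n + 1) → ℤ :=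
  fun i => if i = Fin.last n then 1 else 0

/-- The sets of roots `R_N` for `3 ≤ N ≤ 10` (`N = n+1`). -/
def socRoots (n : ℕ) : Set (Fin (n + 1) → ℤ) :=
  if n ≤ 5 then {extTup n, unitTup n}
  else if n = 6 then {extTup n, unitTup n, onesTup n 6}
  else if n = 7 then {extTup n, unitTup n, onesTup n 7, onesTup n 6}
  else if n = 8 then
    {extTup n, unitTup n, onesTup n 8, onesTup n 7, onesTup n 6, twosTup n 7}
  else
    {extTup n, onesTup n 9, unitTup n, onesTup n 8, onesTup n 7, onesTup n 6,
      twosTup n 8, twosTup n 7}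

/-- The generators of the group `G`: `A_N⁺`, the sign flips `Q₁,…,Q_{N-1}`, and the
transpositions `P_{1,2},…,P_{1,N-1}` (as units of the integer matrix ring). -/
def socGens (n : ℕ) : Set (Matrix (Fin (n + 1)) (Fin (n + 1)) ℤ)ˣ :=
  {g | (g : Matrix (Fin (n + 1)) (Fin (n + 1)) ℤ) = AmatPlus n ∨
    (∃ k : Fin n, (g : Matrix (Fin (n + 1)) (Fin (n + 1)) ℤ) = Qmat k.castSucc) ∨
    (∃ j : Fin (n + 1), j ≠ 0 ∧ j ≠ Fin.last n ∧
      (g : Matrix (Fin (n + 1)) (Fin (n + 1)) ℤ) = (Equiv.swap 0 j).permMatrix ℤ)}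

/-- The spatial coordinates of `s`, extended by zero to `ℕ`. -/
def spc {n : ℕ} (s : Fin (n + 1) → ℤ) (i : ℕ) : ℤ :=
  if h : i < n then s ⟨i, by omega⟩ else 0

/-- The pairing of `s` with the reflection vector. -/
def dval {n : ℕ} (s : Fin (n + 1) → ℤ) : ℤ :=
  spc s 0 + spc s 1 + spc s 2 - s (Fin.last n)

/-- The multiplier of the reflection. -/
def mval (n : ℕ) : ℤ := if n = 2 then 2 else 1

theorem amatPlus_mulVec (n : ℕ) (h3 : 2 ≤ n) (h10 : n ≤ 9) (s : Fin (n + 1) → ℤ)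
    (i : Fin (n + 1)) :
    (AmatPlus n).mulVec s i = (if i = Fin.last n then 1 else -1) *
      (s i - mval n * dval s * (if (i : ℕ) < 3 ∨ i = Fin.last n then 1 else 0)) := by
  rw [AmatPlus, ← Matrix.mulVec_mulVec, Matrix.mulVec_diagonal]
  congr 1
  interval_cases n <;> fin_cases i <;>
    simp [Matrix.mulVec, dotProduct, Amat, Fin.sum_univ_succ, mval, dval, spc] <;> ring

theorem amatPlus_inv (n : ℕ) (h3 : 2 ≤ n) (h10 : n ≤ 9) :
    AmatPlus n * (Amat n *
      (Matrix.diagonal fun i : Fin (n + 1) => if i = Fin.last n then 1 else -1)) = 1 := by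
  interval_cases n <;> decide +kernel

theorem amatPlus_inv' (n : ℕ) (h3 : 2 ≤ n) (h10 : n ≤ 9) :
    (Amat n *
      (Matrix.diagonal fun i : Fin (n + 1) => if i = Fin.last n then 1 else -1)) *
        AmatPlus n = 1 :=
  mul_eq_one_comm.mp (amatPlus_inv n h3 h10)

theorem amatPlus_form (n : ℕ) (h3 : 2 ≤ n) (h10 : n ≤ 9) (s : Fin (n + 1) → ℤ) :
    (∑ i : Fin n, ((AmatPlus n).mulVec s) i.castSucc ^ 2)
      - ((AmatPlus n).mulVec s) (Fin.last n) ^ 2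
      = (∑ i : Fin n, s i.castSucc ^ 2) - s (Fin.last n) ^ 2 := by
  simp only [amatPlus_mulVec n h3 h10]
  interval_cases n <;>
    simp [Fin.sum_univ_succ, mval, dval, spc, Fin.ext_iff, Fin.last] <;> ring

theorem spc_sq (n : ℕ) (h3 : 2 ≤ n) (h10 : n ≤ 9) (s : Fin (n + 1) → ℤ) :
    spc s 0 ^ 2 + spc s 1 ^ 2 + spc s 2 ^ 2 ≤ ∑ i : Fin n, s i.castSucc ^ 2 := by
  interval_cases n <;>
    simp [Fin.sum_univ_succ, spc] <;> 
    nlinarith [sq_nonneg (s 3), sq_nonneg (s 4), sq_nonneg (s 5), sq_nonneg (s 6),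
      sq_nonneg (s 7), sq_nonneg (s 8)]

theorem three_bound (x y z t : ℤ) (h : x ^ 2 + y ^ 2 + z ^ 2 ≤ t ^ 2) (ht : 0 ≤ t) :
    x + y + z ≤ 2 * t := by
  nlinarith [sq_nonneg (x - y), sq_nonneg (y - z), sq_nonneg (x - z), sq_nonneg (x + y + z)]

theorem three_bound_strict (x y z t : ℤ) (h : x ^ 2 + y ^ 2 + z ^ 2 ≤ t ^ 2) (ht : 0 < t) :
    x + y + z < 2 * t := by
  nlinarith [sq_nonneg (x - y), sq_nonneg (y - z), sq_nonneg (x - z), sq_nonneg (x + y + z)]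

theorem two_bound (x y t : ℤ) (h : x ^ 2 + y ^ 2 ≤ t ^ 2) (ht : 0 ≤ t) :
    2 * (x + y) ≤ 3 * t := by
  nlinarith [sq_nonneg (x - y), sq_nonneg (x + y)]

theorem two_bound_strict (x y t : ℤ) (h : x ^ 2 + y ^ 2 ≤ t ^ 2) (ht : 0 < t) :
    2 * (x + y) < 3 * t := by
  nlinarith [sq_nonneg (x - y), sq_nonneg (x + y)]

theorem amatPlus_last (n : ℕ) (h3 : 2 ≤ n) (h10 : n ≤ 9) (s : Fin (n + 1) → ℤ) :
    (AmatPlus n).mulVec s (Fin.last n) = s (Fin.last n) - mval n * dval s := by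
  simp [amatPlus_mulVec n h3 h10]

theorem amatPlus_memT (n : ℕ) (h3 : 2 ≤ n) (h10 : n ≤ 9) (s : Fin (n + 1) → ℤ) :
    memT ((AmatPlus n).mulVec s) ↔ memT s := by
  have hf := amatPlus_form n h3 h10 s
  have hq := spc_sq n h3 h10 s
  have hl := amatPlus_last n h3 h10 s
  unfold memT
  have hm : (2 < n ∧ mval n = 1) ∨ (mval n = 2 ∧ spc s 2 = 0) := by
    rcases h3.lt_or_eq with h | h
    · left; exact ⟨h, by simp [mval]; omega⟩
    · right; subst h; simp [mval, spc]
  unfold dval at hl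
  constructor
  · rintro ⟨h1, h2⟩
    refine ⟨?_, by linarith⟩
    by_contra hneg
    push Not at hneg
    have hx : spc s 0 ^ 2 + spc s 1 ^ 2 + spc s 2 ^ 2 ≤ (s (Fin.last n)) ^ 2 := by linarith
    rcases hm with ⟨_, hm⟩ | ⟨hm, h0⟩
    · have := three_bound_strict (-spc s 0) (-spc s 1) (-spc s 2) (-s (Fin.last n))
        (by linarith) (by linarith)
      rw [hm] at hl; linarith
    · rw [h0] at hx hl
      have := two_bound_strict (-spc s 0) (-spc s 1) (-s (Fin.last n))
        (by linarith) (by linarith)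
      rw [hm] at hl; linarith
  · rintro ⟨h1, h2⟩
    refine ⟨?_, by linarith⟩
    have hx : spc s 0 ^ 2 + spc s 1 ^ 2 + spc s 2 ^ 2 ≤ (s (Fin.last n)) ^ 2 := by linarith
    rcases hm with ⟨_, hm⟩ | ⟨hm, h0⟩
    · have := three_bound _ _ _ _ hx h1
      rw [hm] at hl; linarith
    · rw [h0] at hx hl
      have := two_bound (spc s 0) (spc s 1) _ (by linarith) h1
      rw [hm] at hl; linarith

theorem qmat_mulVec {n : ℕ} (k : Fin n) (s : Fin n → ℤ) (i : Fin n) :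
    (Qmat k).mulVec s i = if i = k then - s i else s i := by
  rw [Qmat, Matrix.mulVec_diagonal]; split_ifs <;> simp

theorem qmat_memT (n : ℕ) (k : Fin n) (s : Fin (n + 1) → ℤ) :
    memT ((Qmat k.castSucc).mulVec s) ↔ memT s := by
  have h : ∀ i, ((Qmat k.castSucc).mulVec s i) ^ 2 = s i ^ 2 := by
    intro i; rw [qmat_mulVec]; split_ifs <;> simp
  have hl : (Qmat k.castSucc).mulVec s (Fin.last n) = s (Fin.last n) := by
    rw [qmat_mulVec, if_neg (Fin.castSucc_lt_last k).ne']
  simp only [memT, h, hl]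

theorem perm_mulVec {n : ℕ} (σ : Equiv.Perm (Fin n)) (s : Fin n → ℤ) :
    (σ.permMatrix ℤ).mulVec s = s ∘ σ := by
  exact Matrix.permMatrix_mulVec σ

theorem swap_memT (n : ℕ) (j : Fin (n + 1)) (h0 : j ≠ 0) (hj : j ≠ Fin.last n)
    (s : Fin (n + 1) → ℤ) :
    memT (((Equiv.swap 0 j).permMatrix ℤ).mulVec s) ↔ memT s := by
  rw [perm_mulVec]
  have hl : Equiv.swap 0 j (Fin.last n) = Fin.last n := by
    apply Equiv.swap_apply_of_ne_of_ne _ (Ne.symm hj)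
    intro h
    apply h0
    have := congrArg Fin.val h
    simp at this
    subst this
    exact Subsingleton.elim (α := Fin 1) _ _
  have hs : ∑ i, (s ∘ Equiv.swap 0 j) i ^ 2 = ∑ i, s i ^ 2 :=
    Equiv.sum_comp (Equiv.swap 0 j) (fun i => s i ^ 2)
  rw [Fin.sum_univ_castSucc, Fin.sum_univ_castSucc] at hs
  unfold memT
  have hl' : (s ∘ Equiv.swap 0 j) (Fin.last n) = s (Fin.last n) := by simp [hl]
  rw [hl'] at hs ⊢
  rw [add_right_cancel hs]

theorem closure_memT (n : ℕ) (h3 : 2 ≤ n) (h10 : n ≤ 9)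
    (g : (Matrix (Fin (n + 1)) (Fin (n + 1)) ℤ)ˣ) (hg : g ∈ Subgroup.closure (socGens n)) :
    ∀ s, memT ((g : Matrix (Fin (n + 1)) (Fin (n + 1)) ℤ).mulVec s) ↔ memT s := by
  induction hg using Subgroup.closure_induction with
  | mem g hg =>
    intro s
    rcases hg with h | ⟨k, h⟩ | ⟨j, h0, hj, h⟩
    · rw [h]; exact amatPlus_memT n h3 h10 s
    · rw [h]; exact qmat_memT n k s
    · rw [h]; exact swap_memT n j h0 hj s
  | one => intro s; simp
  | mul x y _ _ hx hy =>
    intro s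
    rw [Units.val_mul, ← Matrix.mulVec_mulVec, hx, hy]
  | inv x _ hx =>
    intro s
    rw [← hx, Matrix.mulVec_mulVec, Units.mul_inv, Matrix.one_mulVec]

/-- The additive semigroup generated by the group translates of the roots. -/
def socS (n : ℕ) : AddSubmonoid (Fin (n + 1) → ℤ) :=
  AddSubmonoid.closure {v | ∃ g ∈ Subgroup.closure (socGens n), ∃ r ∈ socRoots n,
    v = (g : Matrix (Fin (n + 1)) (Fin (n + 1)) ℤ).mulVec r}

theorem socS_rep (n : ℕ) (s : Fin (n + 1) → ℤ) (hs : s ∈ socS n) :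
      ∃ (k : ℕ) (lam : Fin k → ℕ)
        (g : Fin k → (Matrix (Fin (n + 1)) (Fin (n + 1)) ℤ)ˣ)
        (r : Fin k → (Fin (n + 1) → ℤ)),
        (∀ i, g i ∈ Subgroup.closure (socGens n)) ∧
        (∀ i, r i ∈ socRoots n) ∧
        s = ∑ i : Fin k,
          (lam i : ℤ) • (g i : Matrix (Fin (n + 1)) (Fin (n + 1)) ℤ).mulVec (r i) := by
  induction hs using AddSubmonoid.closure_induction with
  | mem v hv =>
    obtain ⟨g, hg, r, hr, rfl⟩ := hv
    exact ⟨1, fun _ => 1, fun _ => g, fun _ => r, fun _ => hg, fun _ => hr, by simp⟩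
  | zero => exact ⟨0, Fin.elim0, Fin.elim0, Fin.elim0, fun i => i.elim0, fun i => i.elim0, by simp⟩
  | add x y _ _ hx hy =>
    obtain ⟨k, lam, g, r, hg, hr, rfl⟩ := hx
    obtain ⟨k', lam', g', r', hg', hr', rfl⟩ := hy
    refine ⟨k + k', Fin.append lam lam', Fin.append g g', Fin.append r r', ?_, ?_, ?_⟩
    · intro i; refine Fin.addCases (fun i => ?_) (fun i => ?_) i <;> simp [hg, hg']
    · intro i; refine Fin.addCases (fun i => ?_) (fun i => ?_) i <;> simp [hr, hr']
    · simp [Fin.sum_univ_add]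

theorem socS_smul (n : ℕ) (g : (Matrix (Fin (n + 1)) (Fin (n + 1)) ℤ)ˣ)
    (hg : g ∈ Subgroup.closure (socGens n)) (s : Fin (n + 1) → ℤ) (hs : s ∈ socS n) :
    (g : Matrix (Fin (n + 1)) (Fin (n + 1)) ℤ).mulVec s ∈ socS n := by
  induction hs using AddSubmonoid.closure_induction with
  | mem v hv =>
    obtain ⟨g', hg', r, hr, rfl⟩ := hv
    refine AddSubmonoid.subset_closure ⟨g * g', mul_mem hg hg', r, hr, ?_⟩
    rw [Matrix.mulVec_mulVec, Units.val_mul]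
  | zero => rw [Matrix.mulVec_zero]; exact zero_mem _
  | add x y _ _ hx hy => rw [Matrix.mulVec_add]; exact add_mem hx hy

theorem socS_of_smul (n : ℕ) (g : (Matrix (Fin (n + 1)) (Fin (n + 1)) ℤ)ˣ)
    (hg : g ∈ Subgroup.closure (socGens n)) (s : Fin (n + 1) → ℤ)
    (hs : (g : Matrix (Fin (n + 1)) (Fin (n + 1)) ℤ).mulVec s ∈ socS n) : s ∈ socS n := by
  have := socS_smul n g⁻¹ (inv_mem hg) _ hs
  rwa [Matrix.mulVec_mulVec, Units.inv_mul, Matrix.one_mulVec] at this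

theorem socS_root (n : ℕ) (r : Fin (n + 1) → ℤ) (hr : r ∈ socRoots n) : r ∈ socS n :=
  AddSubmonoid.subset_closure ⟨1, one_mem _, r, hr, by simp⟩

theorem socS_of_amat (n : ℕ) (h3 : 2 ≤ n) (h10 : n ≤ 9) (s : Fin (n + 1) → ℤ)
    (hs : (AmatPlus n).mulVec s ∈ socS n) : s ∈ socS n :=
  socS_of_smul n ⟨AmatPlus n, _, amatPlus_inv n h3 h10, amatPlus_inv' n h3 h10⟩
    (Subgroup.subset_closure (Or.inl rfl)) s hs

theorem qmat_mul_self {n : ℕ} (k : Fin n) : Qmat k * Qmat k = 1 := by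
  rw [Qmat, Matrix.diagonal_mul_diagonal, ← Matrix.diagonal_one]
  congr 1; ext i; split_ifs <;> simp

theorem socS_of_qmat (n : ℕ) (k : Fin n) (s : Fin (n + 1) → ℤ)
    (hs : (Qmat k.castSucc).mulVec s ∈ socS n) : s ∈ socS n :=
  socS_of_smul n ⟨Qmat k.castSucc, Qmat k.castSucc, qmat_mul_self _, qmat_mul_self _⟩
    (Subgroup.subset_closure (Or.inr (Or.inl ⟨k, rfl⟩))) s hs

theorem perm_mul_self {n : ℕ} (i j : Fin n) :
    (Equiv.swap i j).permMatrix ℤ * (Equiv.swap i j).permMatrix ℤ = 1 := by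
  rw [← Matrix.permMatrix_mul, Equiv.swap_mul_self, Matrix.permMatrix_one]

theorem socS_of_swap0 (n : ℕ) (j : Fin (n + 1)) (hj : j ≠ Fin.last n) (s : Fin (n + 1) → ℤ)
    (hs : s ∘ Equiv.swap 0 j ∈ socS n) : s ∈ socS n := by
  by_cases h0 : j = 0
  · subst h0; simpa using hs
  · refine socS_of_smul n ⟨(Equiv.swap 0 j).permMatrix ℤ, (Equiv.swap 0 j).permMatrix ℤ,
      perm_mul_self _ _, perm_mul_self _ _⟩
      (Subgroup.subset_closure (Or.inr (Or.inr ⟨j, h0, hj, rfl⟩))) s ?_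
    rw [perm_mulVec]; exact hs

theorem socS_of_swap (n : ℕ) (i j : Fin (n + 1)) (hi : i ≠ Fin.last n) (hj : j ≠ Fin.last n)
    (s : Fin (n + 1) → ℤ)
    (hs : s ∘ Equiv.swap i j ∈ socS n) : s ∈ socS n := by
  by_cases hij : i = j
  · subst hij; simpa using hs
  by_cases hj0 : j = 0
  · subst hj0; rw [Equiv.swap_comm] at hs; exact socS_of_swap0 n i hi s hs
  apply socS_of_swap0 n i hi
  apply socS_of_swap0 n j hj
  apply socS_of_swap0 n i hi
  convert hs using 1
  rw [Function.comp_assoc, Function.comp_assoc]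
  congr 1
  have : Equiv.swap 0 i * Equiv.swap 0 j * Equiv.swap 0 i = Equiv.swap i j := by
    have h := Equiv.swap_apply_apply (Equiv.swap 0 i) 0 j
    rw [Equiv.swap_apply_left, Equiv.swap_apply_of_ne_of_ne hj0 (Ne.symm hij),
      Equiv.swap_inv] at h
    exact h.symm
  rw [← this]
  rfl

theorem socS_of_perm (n : ℕ) (σ : Equiv.Perm (Fin n)) (t : ℤ) : ∀ (f : Fin n → ℤ),
    (Fin.snoc (f ∘ σ) t : Fin (n + 1) → ℤ) ∈ socS n → (Fin.snoc f t : Fin (n + 1) → ℤ) ∈ socS n := by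
  induction σ using Equiv.Perm.swap_induction_on with
  | one => intro f h; simpa using h
  | swap_mul σ x y hxy ih =>
    intro f h
    apply socS_of_swap n x.castSucc y.castSucc (Fin.castSucc_lt_last x).ne
      (Fin.castSucc_lt_last y).ne
    have : (Fin.snoc f t : Fin (n + 1) → ℤ) ∘ Equiv.swap x.castSucc y.castSucc =
        (Fin.snoc (f ∘ Equiv.swap x y) t : Fin (n + 1) → ℤ) := by
      ext i
      refine Fin.lastCases ?_ (fun i => ?_) i
      · rw [Function.comp_apply, Equiv.swap_apply_of_ne_of_ne (Fin.castSucc_lt_last x).ne'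
          (Fin.castSucc_lt_last y).ne']
        simp
      · have : Equiv.swap x.castSucc y.castSucc i.castSucc = (Equiv.swap x y i).castSucc := by
          simp only [Equiv.swap_apply_def, Fin.castSucc_inj]; split_ifs <;> rfl
        rw [Function.comp_apply, this]
        simp
    rw [this]
    exact ih _ h

theorem socS_of_signs (n : ℕ) (F : Finset (Fin n)) (t : ℤ) : ∀ (f : Fin n → ℤ),
    (Fin.snoc (fun i => if i ∈ F then - f i else f i) t : Fin (n + 1) → ℤ) ∈ socS n →
    (Fin.snoc f t : Fin (n + 1) → ℤ) ∈ socS n := by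
  induction F using Finset.induction_on with
  | empty => intro f h; simpa using h
  | insert a F ha ih =>
    intro f h
    apply ih
    apply socS_of_qmat n a
    convert h using 1
    ext i
    rw [qmat_mulVec]
    refine Fin.lastCases ?_ (fun i => ?_) i
    · simp [(Fin.castSucc_lt_last a).ne']
    · simp only [Fin.snoc_castSucc, Fin.castSucc_inj, Finset.mem_insert]
      by_cases hia : i = a
      · subst hia; simp [ha]
      · simp [hia]

/-- The vector with `k` ones, then zeros, and last entry `c`. -/
def tup (n k : ℕ) (c : ℤ) : Fin (n + 1) → ℤ :=
  fun i => if i = Fin.last n then c else if (i : ℕ) < k then 1 else 0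

/-- The vector `e_j + e_N`. -/
def evec (n : ℕ) (j : Fin n) : Fin (n + 1) → ℤ :=
  fun i => if i = j.castSucc ∨ i = Fin.last n then 1 else 0

theorem ext_mem_roots (n : ℕ) : extTup n ∈ socRoots n := by
  unfold socRoots; split_ifs <;> simp

theorem unit_mem_roots (n : ℕ) : unitTup n ∈ socRoots n := by
  unfold socRoots; split_ifs <;> simp

theorem evec_mem (n : ℕ) (j : Fin n) : evec n j ∈ socS n := by
  apply socS_of_swap0 n j.castSucc (Fin.castSucc_lt_last j).ne
  convert socS_root n _ (ext_mem_roots n) using 1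
  have hn : (0 : Fin (n + 1)) ≠ Fin.last n := by
    have := j.pos
    intro h
    have := congrArg Fin.val h
    simp at this; omega
  ext i
  simp only [Function.comp_apply, evec, extTup]
  congr 1
  simp only [Equiv.swap_apply_def]
  have := (Fin.castSucc_lt_last j).ne
  grind

theorem tup_three (n : ℕ) (h3 : 3 ≤ n) (h10 : n ≤ 9) : tup n 3 2 ∈ socS n := by
  apply socS_of_amat n (by omega) h10
  convert socS_root n _ (unit_mem_roots n) using 1
  interval_cases n <;> decide +kernel +revert

theorem tup_four (n : ℕ) (h3 : 4 ≤ n) (h10 : n ≤ 9) : tup n 4 2 ∈ socS n := by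
  apply socS_of_amat n (by omega) h10
  apply socS_of_qmat n ⟨3, by omega⟩
  convert evec_mem n ⟨3, by omega⟩ using 1
  interval_cases n <;> decide +kernel +revert

theorem tup_mem (n : ℕ) (h3 : 2 ≤ n) (h10 : n ≤ 9) (k : ℕ) (hk : k < n) :
    tup n (k + 1) (min (k + 1) 3 : ℕ) ∈ socS n := by
  by_cases hk5 : 5 ≤ k
  · have : tup n (k + 1) (min (k + 1) 3 : ℕ) = onesTup n (k + 1) := by
      rw [min_eq_right (by omega)]; rfl
    rw [this]
    apply socS_root
    interval_cases n <;> interval_cases k <;> simp [socRoots]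
  have hk5 : k < 5 := by omega
  interval_cases k
  · convert evec_mem n ⟨0, by omega⟩ using 1
    interval_cases n <;> decide +kernel +revert
  · convert add_mem (evec_mem n ⟨0, by omega⟩) (evec_mem n ⟨1, by omega⟩) using 1
    interval_cases n <;> decide +kernel +revert
  · convert add_mem (add_mem (evec_mem n ⟨0, by omega⟩) (evec_mem n ⟨1, by omega⟩))
      (evec_mem n ⟨2, by omega⟩) using 1
    interval_cases n <;> decide +kernel +revert
  · convert add_mem (tup_three n (by omega) h10) (evec_mem n ⟨3, by omega⟩) using 1
    interval_cases n <;> decide +kernel +revert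
  · convert add_mem (tup_four n (by omega) h10) (evec_mem n ⟨4, by omega⟩) using 1
    interval_cases n <;> decide +kernel +revert

theorem zsmul_mem_of_nonneg {n : ℕ} (c : ℤ) (hc : 0 ≤ c) (v : Fin (n + 1) → ℤ)
    (hv : v ∈ socS n) : c • v ∈ socS n := by
  lift c to ℕ using hc
  rw [natCast_zsmul]
  exact nsmul_mem hv c

set_option maxRecDepth 10000 in
theorem chamber_decomp (n : ℕ) (h3 : 2 ≤ n) (h10 : n ≤ 9) (s : Fin (n + 1) → ℤ) :
    s = (- dval s) • unitTup n +
      ∑ k ∈ Finset.range n, (spc s k - spc s (k + 1)) • tup n (k + 1) (min (k + 1) 3 : ℕ) := by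
  ext i
  rw [Pi.add_apply, Finset.sum_apply]
  simp only [Pi.smul_apply, smul_eq_mul, unitTup, tup, dval]
  interval_cases n <;> fin_cases i <;>
    simp [Finset.sum_range_succ, spc, Fin.ext_iff, Fin.last] <;> ring

theorem chamber_mem (n : ℕ) (h3 : 2 ≤ n) (h10 : n ≤ 9) (s : Fin (n + 1) → ℤ)
    (hd : dval s ≤ 0) (hs : ∀ k < n, spc s (k + 1) ≤ spc s k) : s ∈ socS n := by
  rw [chamber_decomp n h3 h10 s]
  refine add_mem (zsmul_mem_of_nonneg _ (by omega) _ (socS_root n _ (unit_mem_roots n))) ?_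
  refine sum_mem fun k hk => ?_
  have hk := Finset.mem_range.mp hk
  have := hs k hk
  exact zsmul_mem_of_nonneg _ (by omega) _ (tup_mem n h3 h10 k hk)

theorem memT_snoc {n : ℕ} (f : Fin n → ℤ) (t : ℤ) :
    memT (Fin.snoc f t : Fin (n + 1) → ℤ) ↔ 0 ≤ t ∧ ∑ i, f i ^ 2 ≤ t ^ 2 := by
  simp [memT]

theorem all_mem (n : ℕ) (h3 : 2 ≤ n) (h10 : n ≤ 9) (M : ℕ) : ∀ s : Fin (n + 1) → ℤ,
    memT s → s (Fin.last n) = M → s ∈ socS n := by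
  induction M using Nat.strong_induction_on with
  | _ M ih =>
  have sorted : ∀ f : Fin n → ℤ, Antitone f → (∀ i, 0 ≤ f i) →
      memT (Fin.snoc f (M : ℤ) : Fin (n + 1) → ℤ) →
      (Fin.snoc f (M : ℤ) : Fin (n + 1) → ℤ) ∈ socS n := by
    intro f hf h0 hT
    set s : Fin (n + 1) → ℤ := Fin.snoc f (M : ℤ) with hsdef
    have hspc : ∀ i (h : i < n), spc s i = f ⟨i, h⟩ := by
      intro i h
      rw [spc, dif_pos h]
      exact Fin.snoc_castSucc (α := fun _ => ℤ) (M : ℤ) f ⟨i, h⟩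
    have hlast : s (Fin.last n) = M := by simp [hsdef]
    by_cases hd : dval s ≤ 0
    · apply chamber_mem n h3 h10 s hd
      intro k hk
      rw [hspc k hk]
      by_cases hk1 : k + 1 < n
      · rw [hspc _ hk1]
        apply hf
        simp
      · rw [spc, dif_neg hk1]; exact h0 _
    · push Not at hd
      apply socS_of_amat n h3 h10
      have hT' := (amatPlus_memT n h3 h10 s).mpr hT
      have hl := amatPlus_last n h3 h10 s
      have hm : 1 ≤ mval n := by unfold mval; split_ifs <;> norm_num
      have hlt : (AmatPlus n).mulVec s (Fin.last n) < M := by nlinarith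
      have hge := hT'.1
      refine ih ((AmatPlus n).mulVec s (Fin.last n)).toNat (by omega) _ hT' ?_
      exact (Int.toNat_of_nonneg hge).symm
  have nonneg : ∀ f : Fin n → ℤ, (∀ i, 0 ≤ f i) →
      memT (Fin.snoc f (M : ℤ) : Fin (n + 1) → ℤ) →
      (Fin.snoc f (M : ℤ) : Fin (n + 1) → ℤ) ∈ socS n := by
    intro f h0 hT
    have hmono := Tuple.monotone_sort (fun i => - f i)
    apply socS_of_perm n (Tuple.sort (fun i => - f i))
    apply sorted
    · intro a b hab
      have := hmono hab
      simpa using this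
    · intro i; exact h0 _
    · rw [memT_snoc] at hT ⊢
      refine ⟨hT.1, le_trans (le_of_eq ?_) hT.2⟩
      exact Equiv.sum_comp (Tuple.sort (fun i => - f i)) (fun i => f i ^ 2)
  intro s hT hM
  have hs : s = (Fin.snoc (fun i : Fin n => s i.castSucc) (M : ℤ) : Fin (n + 1) → ℤ) := by
    ext i
    refine Fin.lastCases ?_ (fun i => ?_) i <;> simp [hM]
  rw [hs] at hT ⊢
  apply socS_of_signs n (Finset.univ.filter fun i => s i.castSucc < 0)
  apply nonneg
  · intro i
    simp only [Finset.mem_filter, Finset.mem_univ, true_and]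
    split_ifs <;> omega
  · rw [memT_snoc] at hT ⊢
    refine ⟨hT.1, le_trans (le_of_eq ?_) hT.2⟩
    refine Finset.sum_congr rfl fun i _ => ?_
    split_ifs <;> simp

/-- For `3 ≤ N ≤ 10` (`N = n+1`), the group `G` generated by `A_N⁺`,
`Q₁,…,Q_{N-1}`, `P_{1,2},…,P_{1,N-1}` preserves `T_N`, the set of roots `R_N` is
finite, and every `s ∈ T_N` is a nonnegative-integer combination
`s = ∑ λᵢ gᵢ rᵢ` with `gᵢ ∈ G` and `rᵢ ∈ R_N`. -/
theorem soc_semigroup_RG_finitely_generated (n : ℕ) (h3 : 2 ≤ n) (h10 : n ≤ 9) :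
    (∀ g ∈ Subgroup.closure (socGens n),
      (fun s : Fin (n + 1) → ℤ =>
          (g : Matrix (Fin (n + 1)) (Fin (n + 1)) ℤ).mulVec s) '' {s | memT s}
        = {s | memT s}) ∧
    (socRoots n).Finite ∧
    (∀ s : Fin (n + 1) → ℤ, memT s →
      ∃ (k : ℕ) (lam : Fin k → ℕ)
        (g : Fin k → (Matrix (Fin (n + 1)) (Fin (n + 1)) ℤ)ˣ)
        (r : Fin k → (Fin (n + 1) → ℤ)),
        (∀ i, g i ∈ Subgroup.closure (socGens n)) ∧
        (∀ i, r i ∈ socRoots n) ∧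
        s = ∑ i : Fin k,
          (lam i : ℤ) • (g i : Matrix (Fin (n + 1)) (Fin (n + 1)) ℤ).mulVec (r i)) := by
  refine ⟨?_, ?_, ?_⟩
  · intro g hg
    have h := closure_memT n h3 h10 g hg
    ext s
    constructor
    · rintro ⟨x, hx, rfl⟩
      exact (h x).mpr hx
    · intro hs
      refine ⟨((g⁻¹ : (Matrix (Fin (n + 1)) (Fin (n + 1)) ℤ)ˣ) :
        Matrix (Fin (n + 1)) (Fin (n + 1)) ℤ).mulVec s, ?_, ?_⟩
      · exact (closure_memT n h3 h10 g⁻¹ (inv_mem hg) s).mpr hs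
      · simp only [Matrix.mulVec_mulVec, Units.mul_inv, Matrix.one_mulVec]
  · unfold socRoots
    split_ifs <;> exact Set.toFinite _
  · intro s hs
    exact socS_rep n s (all_mem n h3 h10 (s (Fin.last n)).toNat s hs
      (Int.toNat_of_nonneg hs.1).symm)
end
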